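/- Let B_1 denote the open unit disc in ℝ². Suppose K ∈ L^∞(B_1) is nonnegative and u ∈ C²(B_1 \ {0}) is a solution of −Δu = K(x) e^u in B_1 \ {0} satisfying ∫_{B_1 \ {0}} e^{u(x)} dx < ∞. Then there exist a constant α > −2, an exponent γ ∈ (0,1), and a function φ that is γ-Hölder continuous on a neighborhood of the origin, such that u(x) = α ln|x| + φ(x) for all x ≠ 0 in that neighborhood. -/

import Mathlib

open MeasureTheory Metric Real Set
open scoped ENNReal NNReal

noncomputable section

/-- First-order partial derivative in direction `i`. -/
def pderiv1 {n : ℕ} (i : Fin n) (f : EuclideanSpace ℝ (Fin n) → ℝ) :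
    EuclideanSpace ℝ (Fin n) → ℝ :=
  fun x => fderiv ℝ f x (EuclideanSpace.single i 1)

/-- The Laplacian `Δf = ∑ ∂²f/∂xᵢ²`. -/
def lap {n : ℕ} (f : EuclideanSpace ℝ (Fin n) → ℝ) : EuclideanSpace ℝ (Fin n) → ℝ :=
  fun x => ∑ i, pderiv1 i (pderiv1 i f) x

/-- The negative Laplacian `-Δ`. -/
def nlap {n : ℕ} (f : EuclideanSpace ℝ (Fin n) → ℝ) : EuclideanSpace ℝ (Fin n) → ℝ :=
  fun x => -(lap f x)

/-- `(-Δ)^m`, the m-th iterate of the negative Laplacian. -/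
def nlapIter {n : ℕ} (m : ℕ) (f : EuclideanSpace ℝ (Fin n) → ℝ) :
    EuclideanSpace ℝ (Fin n) → ℝ :=
  nlap^[m] f

/-- `D^β`, the mixed partial derivative associated to a multi-index `β`. -/
def mderiv {n : ℕ} (β : Fin n → ℕ) (f : EuclideanSpace ℝ (Fin n) → ℝ) :
    EuclideanSpace ℝ (Fin n) → ℝ :=
  ((List.finRange n).foldr (fun i F => F ∘ (pderiv1 i)^[β i]) id) f

/-- The finset of multi-indices `β` with `|β| ≤ s`. -/
def degLE (n s : ℕ) : Finset (Fin n → ℕ) :=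
  (Fintype.piFinset fun _ : Fin n => Finset.range (s+1)).filter fun β => ∑ i, β i ≤ s

/-- The finset of multi-indices `β` with `|β| < s` (i.e. `|β| ≤ s - 1`; empty for `s = 0`). -/
def degLT (n s : ℕ) : Finset (Fin n → ℕ) :=
  (Fintype.piFinset fun _ : Fin n => Finset.range s).filter fun β => ∑ i, β i < s

/-- Fundamental-solution profile of `(-Δ)^m` on `ℝⁿ`:
`c‖x‖^{2m-n}` for `n > 2m` and `c ln(5/‖x‖)` for `n = 2m`. -/
def fundSol (m n : ℕ) (c : ℝ) : EuclideanSpace ℝ (Fin n) → ℝ :=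
  fun x => if n = 2*m then c * Real.log (5 / ‖x‖) else c * ‖x‖ ^ ((2*m : ℤ) - n)

/-- `ψ(x,y) = φ(x-y) - ∑_{|β| ≤ s-1} ((-y)^β/β!) D^β φ(x)`. -/
def psiFun (m n s : ℕ) (c : ℝ) (x y : EuclideanSpace ℝ (Fin n)) : ℝ :=
  fundSol m n c (x - y) -
    ∑ β ∈ degLT n s,
      ((∏ i, (-(y i)) ^ β i) / ∏ i, ((β i).factorial : ℝ)) * mderiv β (fundSol m n c) x

/-- `N(x) = ∫_{|y| ≤ 1} ψ(x,y) f(y) dy`. -/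
def NFun (m n s : ℕ) (c : ℝ) (f : EuclideanSpace ℝ (Fin n) → ℝ)
    (x : EuclideanSpace ℝ (Fin n)) : ℝ :=
  ∫ y in closedBall (0 : EuclideanSpace ℝ (Fin n)) 1, psiFun m n s c x y * f y

open Filter Topology in
/-- Differentiation under the integral sign on a compact interval, for jointly continuous
derivatives. -/
lemma hasDerivAt_intervalIntegral_of_continuousOn {F F' : ℝ → ℝ → ℝ} {S : Set ℝ} {a b : ℝ}
    (hab : a ≤ b) (hS : IsOpen S) (hF : ∀ s ∈ S, ContinuousOn (F s) (Icc a b))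
    (hF' : ContinuousOn (fun p : ℝ × ℝ => F' p.1 p.2) (S ×ˢ Icc a b))
    (hd : ∀ s ∈ S, ∀ θ ∈ Icc a b, HasDerivAt (fun s => F s θ) (F' s θ) s) {s : ℝ} (hs : s ∈ S) :
    HasDerivAt (fun s => ∫ θ in a..b, F s θ) (∫ θ in a..b, F' s θ) s := by
  obtain ⟨δ, hδ, hball⟩ := Metric.isOpen_iff.1 hS s hs
  have hsub : closedBall s (δ / 2) ⊆ S :=
    (closedBall_subset_ball (by linarith)).trans hball
  have hK : IsCompact (closedBall s (δ / 2) ×ˢ Icc a b) :=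
    (isCompact_closedBall _ _).prod isCompact_Icc
  obtain ⟨C, hC⟩ := hK.exists_bound_of_continuousOn (hF'.mono (prod_mono_left hsub))
  have hI : uIoc a b ⊆ Icc a b := by rw [uIoc_of_le hab]; exact Ioc_subset_Icc_self
  refine (intervalIntegral.hasDerivAt_integral_of_dominated_loc_of_deriv_le
    (F := F) (F' := F') (bound := fun _ => C) (s := closedBall s (δ / 2))
    (closedBall_mem_nhds _ (by positivity)) ?_ ?_ ?_ ?_ ?_ ?_).2
  · filter_upwards [hS.mem_nhds hs] with x hx
    exact ((hF x hx).mono hI).aestronglyMeasurable measurableSet_uIoc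
  · exact ContinuousOn.intervalIntegrable (by rw [uIcc_of_le hab]; exact hF s hs)
  · have : ContinuousOn (F' s) (Icc a b) :=
      hF'.comp (f := fun θ => (s, θ)) (by fun_prop) (fun θ hθ => ⟨hs, hθ⟩)
    exact (this.mono hI).aestronglyMeasurable measurableSet_uIoc
  · exact ae_of_all _ fun θ hθ x hx => hC (x, θ) ⟨hx, hI hθ⟩
  · simp
  · exact ae_of_all _ fun θ hθ x hx => hd x (hsub hx) θ (hI hθ)

section CircleMean

variable {U : ℂ → ℝ} {z : ℂ} {R : ℝ}

lemma circleMap_mem_ball_of_lt {s : ℝ} (hs : 0 ≤ s) (hsR : s < R) (θ : ℝ) :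
    circleMap z s θ ∈ ball z R := by
  rw [mem_ball, dist_eq_norm, circleMap_sub_center, norm_circleMap_zero, abs_of_nonneg hs]
  exact hsR

lemma circleMap_mem_ball_of_abs_lt {s : ℝ} (hsR : |s| < R) (θ : ℝ) :
    circleMap z s θ ∈ ball z R := by
  rw [mem_ball, dist_eq_norm, circleMap_sub_center, norm_circleMap_zero]
  exact hsR

lemma continuous_circleMap_uncurry : Continuous (fun p : ℝ × ℝ => circleMap z p.1 p.2) := by
  unfold circleMap; fun_prop

/-- The radial derivative of `U`. -/
def radialDeriv (U : ℂ → ℝ) (z : ℂ) (s θ : ℝ) : ℝ :=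
  fderiv ℝ U (circleMap z s θ) (Complex.exp (θ * Complex.I))

/-- The second radial derivative of `U`. -/
def radialDeriv2 (U : ℂ → ℝ) (z : ℂ) (s θ : ℝ) : ℝ :=
  fderiv ℝ (fderiv ℝ U) (circleMap z s θ) (Complex.exp (θ * Complex.I))
    (Complex.exp (θ * Complex.I))

lemma hasDerivAt_circleMap_radius (s θ : ℝ) :
    HasDerivAt (fun s : ℝ => circleMap z s θ) (Complex.exp (θ * Complex.I)) s := by
  unfold circleMap
  have := ((hasDerivAt_id s).ofReal_comp.mul_const (Complex.exp (θ * Complex.I))).const_add z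
  simpa using this

lemma hasDerivAt_expI (θ : ℝ) :
    HasDerivAt (fun θ : ℝ => Complex.exp (θ * Complex.I))
      (Complex.I * Complex.exp (θ * Complex.I)) θ := by
  have := ((hasDerivAt_id θ).ofReal_comp.mul_const Complex.I).cexp
  simpa [mul_comm] using this

variable (hU : ContDiffOn ℝ 2 U (ball z R))
include hU

lemma hasFDerivAt_of_contDiffOn_two {w : ℂ} (hw : w ∈ ball z R) :
    HasFDerivAt U (fderiv ℝ U w) w :=
  ((hU.contDiffAt (isOpen_ball.mem_nhds hw)).differentiableAt (by norm_num)).hasFDerivAt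

lemma contDiffOn_fderiv_one : ContDiffOn ℝ 1 (fderiv ℝ U) (ball z R) :=
  ((contDiffOn_succ_iff_fderiv_of_isOpen (n := 1) isOpen_ball).1 (by norm_num; exact hU)).2.2

lemma hasFDerivAt_fderiv_of_contDiffOn_two {w : ℂ} (hw : w ∈ ball z R) :
    HasFDerivAt (fderiv ℝ U) (fderiv ℝ (fderiv ℝ U) w) w :=
  (((contDiffOn_fderiv_one hU).contDiffAt (isOpen_ball.mem_nhds hw)).differentiableAt
    (by norm_num)).hasFDerivAt

lemma continuousOn_fderiv_fderiv : ContinuousOn (fderiv ℝ (fderiv ℝ U)) (ball z R) :=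
  (contDiffOn_fderiv_one hU).continuousOn_fderiv_of_isOpen isOpen_ball (by norm_num)

lemma continuousOn_radialDeriv :
    ContinuousOn (fun p : ℝ × ℝ => radialDeriv U z p.1 p.2) (Ioo (-R) R ×ˢ Icc 0 (2 * π)) := by
  unfold radialDeriv
  refine ContinuousOn.clm_apply ?_ (by fun_prop)
  exact (contDiffOn_fderiv_one hU).continuousOn.comp continuous_circleMap_uncurry.continuousOn
    fun p hp => circleMap_mem_ball_of_abs_lt (abs_lt.2 hp.1) _

lemma continuousOn_radialDeriv2 :
    ContinuousOn (fun p : ℝ × ℝ => radialDeriv2 U z p.1 p.2) (Ioo (-R) R ×ˢ Icc 0 (2 * π)) := by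
  unfold radialDeriv2
  refine ContinuousOn.clm_apply (ContinuousOn.clm_apply ?_ (by fun_prop)) (by fun_prop)
  exact (continuousOn_fderiv_fderiv hU).comp continuous_circleMap_uncurry.continuousOn
    fun p hp => circleMap_mem_ball_of_abs_lt (abs_lt.2 hp.1) _

lemma hasDerivAt_comp_circleMap {s : ℝ} (hs : s ∈ Ioo (-R) R) (θ : ℝ) :
    HasDerivAt (fun s => U (circleMap z s θ)) (radialDeriv U z s θ) s :=
  (hasFDerivAt_of_contDiffOn_two hU (circleMap_mem_ball_of_abs_lt (abs_lt.2 hs) θ)).comp_hasDerivAt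
    s (hasDerivAt_circleMap_radius s θ)

lemma hasDerivAt_radialDeriv {s : ℝ} (hs : s ∈ Ioo (-R) R) (θ : ℝ) :
    HasDerivAt (fun s => radialDeriv U z s θ) (radialDeriv2 U z s θ) s := by
  have h := (hasFDerivAt_fderiv_of_contDiffOn_two hU
    (circleMap_mem_ball_of_abs_lt (abs_lt.2 hs) θ)).comp_hasDerivAt
    s (hasDerivAt_circleMap_radius s θ)
  have h2 := h.clm_apply (hasDerivAt_const s (Complex.exp (θ * Complex.I)))
  rw [map_zero, add_zero] at h2
  exact h2

lemma hasDerivAt_integral_circleMap {s : ℝ} (hs : s ∈ Ioo (-R) R) :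
    HasDerivAt (fun s => ∫ θ in 0..2 * π, U (circleMap z s θ))
      (∫ θ in 0..2 * π, radialDeriv U z s θ) s := by
  refine hasDerivAt_intervalIntegral_of_continuousOn (F := fun s θ => U (circleMap z s θ))
    (by positivity) isOpen_Ioo (fun s hs => ?_)
    (continuousOn_radialDeriv hU) (fun s hs θ _ => hasDerivAt_comp_circleMap hU hs θ) hs
  exact hU.continuousOn.comp (continuous_circleMap z s).continuousOn
    fun θ _ => circleMap_mem_ball_of_abs_lt (abs_lt.2 hs) θ

lemma hasDerivAt_integral_radialDeriv {s : ℝ} (hs : s ∈ Ioo (-R) R) :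
    HasDerivAt (fun s => ∫ θ in 0..2 * π, radialDeriv U z s θ)
      (∫ θ in 0..2 * π, radialDeriv2 U z s θ) s := by
  refine hasDerivAt_intervalIntegral_of_continuousOn
    (by positivity) isOpen_Ioo (fun s hs => ?_)
    (continuousOn_radialDeriv2 hU) (fun s hs θ _ => hasDerivAt_radialDeriv hU hs θ) hs
  exact (continuousOn_radialDeriv hU).comp (f := fun θ => (s, θ)) (by fun_prop)
    fun θ hθ => ⟨hs, hθ⟩

omit hU in
lemma laplacian_eq_rotated (w : ℂ) (θ : ℝ) :
    Laplacian.laplacian U w = fderiv ℝ (fderiv ℝ U) w (Complex.exp (θ * Complex.I))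
        (Complex.exp (θ * Complex.I)) +
      fderiv ℝ (fderiv ℝ U) w (Complex.I * Complex.exp (θ * Complex.I))
        (Complex.I * Complex.exp (θ * Complex.I)) := by
  have e1 : Complex.exp (θ * Complex.I) = Real.cos θ • (1 : ℂ) + Real.sin θ • Complex.I := by
    rw [Complex.exp_mul_I]; simp
  have e2 : Complex.I * Complex.exp (θ * Complex.I)
      = (-Real.sin θ) • (1 : ℂ) + Real.cos θ • Complex.I := by
    rw [Complex.exp_mul_I]; simp [mul_add]; ring_nf; simp [sub_eq_add_neg]
  rw [e2, e1, InnerProductSpace.laplacian_eq_iteratedFDeriv_complexPlane]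
  simp only [iteratedFDeriv_two_apply, map_add, map_smul, add_apply, smul_apply, smul_eq_mul,
    Matrix.cons_val_zero, Matrix.cons_val_one]
  linear_combination (fderiv ℝ (fderiv ℝ U) w 1 1 + fderiv ℝ (fderiv ℝ U) w Complex.I Complex.I) *
    (-(Real.sin_sq_add_cos_sq θ))

lemma integral_angular_eq_zero {s : ℝ} (hs : s ∈ Ioo (-R) R) :
    ∫ θ in 0..2 * π, (fderiv ℝ (fderiv ℝ U) (circleMap z s θ)
      (s * (Complex.I * Complex.exp (θ * Complex.I)))
      (s * (Complex.I * Complex.exp (θ * Complex.I)))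
      - s * radialDeriv U z s θ) = 0 := by
  have hm : ∀ θ, circleMap z s θ ∈ ball z R := fun θ => circleMap_mem_ball_of_abs_lt (abs_lt.2 hs) θ
  have hc : ∀ θ : ℝ, HasDerivAt (fun θ : ℝ => circleMap z s θ)
      (s * (Complex.I * Complex.exp (θ * Complex.I))) θ := fun θ => by
    unfold circleMap
    exact ((hasDerivAt_expI θ).const_mul (s : ℂ)).const_add z
  have hv : ∀ θ : ℝ, HasDerivAt (fun θ : ℝ => (s * (Complex.I * Complex.exp (θ * Complex.I)) : ℂ))
      (-(s * Complex.exp (θ * Complex.I))) θ := fun θ => by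
    have := ((hasDerivAt_expI θ).const_mul Complex.I).const_mul (s : ℂ)
    rwa [← mul_assoc Complex.I Complex.I, Complex.I_mul_I, neg_one_mul, mul_neg] at this
  have hder : ∀ θ ∈ uIcc 0 (2 * π), HasDerivAt
      (fun θ : ℝ => fderiv ℝ U (circleMap z s θ) (s * (Complex.I * Complex.exp (θ * Complex.I))))
      (fderiv ℝ (fderiv ℝ U) (circleMap z s θ)
      (s * (Complex.I * Complex.exp (θ * Complex.I)))
      (s * (Complex.I * Complex.exp (θ * Complex.I)))
      - s * radialDeriv U z s θ) θ := fun θ _ => by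
    have h := ((hasFDerivAt_fderiv_of_contDiffOn_two hU (hm θ)).comp_hasDerivAt θ (hc θ)).clm_apply
      (hv θ)
    have e : (-(s * Complex.exp (θ * Complex.I)) : ℂ) = -(s • Complex.exp (θ * Complex.I)) := by
      rw [Complex.real_smul]
    have e2 : fderiv ℝ U (circleMap z s θ) (-(s * Complex.exp (θ * Complex.I)))
        = -(s * radialDeriv U z s θ) := by
      rw [e, map_neg, map_smul]; rfl
    rw [Function.comp_apply, e2, ← sub_eq_add_neg] at h
    exact h
  rw [intervalIntegral.integral_eq_sub_of_hasDerivAt hder]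
  · simp [circleMap]
  · refine ContinuousOn.intervalIntegrable ?_
    rw [uIcc_of_le (by positivity)]
    refine ContinuousOn.sub ?_ ?_
    · refine ContinuousOn.clm_apply (ContinuousOn.clm_apply ?_ (by fun_prop)) (by fun_prop)
      exact (continuousOn_fderiv_fderiv hU).comp (continuous_circleMap z s).continuousOn
        fun θ _ => hm θ
    · exact continuousOn_const.mul ((continuousOn_radialDeriv hU).comp (f := fun θ => (s, θ))
        (by fun_prop) fun θ hθ => ⟨hs, hθ⟩)

/-- The Laplacian in polar coordinates, averaged over a circle. -/
lemma integral_laplacian_circleMap {s : ℝ} (hs : s ∈ Ioo (-R) R) :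
    s ^ 2 * ∫ θ in 0..2 * π, Laplacian.laplacian U (circleMap z s θ) =
      s ^ 2 * (∫ θ in 0..2 * π, radialDeriv2 U z s θ) +
        s * ∫ θ in 0..2 * π, radialDeriv U z s θ := by
  have hm : ∀ θ, circleMap z s θ ∈ ball z R := fun θ => circleMap_mem_ball_of_abs_lt (abs_lt.2 hs) θ
  have hpi : (0 : ℝ) ≤ 2 * π := by positivity
  have i1 : IntervalIntegrable (fun θ => radialDeriv U z s θ) volume 0 (2 * π) := by
    refine ContinuousOn.intervalIntegrable ?_
    rw [uIcc_of_le hpi]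
    exact (continuousOn_radialDeriv hU).comp (f := fun θ => (s, θ))
        (by fun_prop) fun θ hθ => ⟨hs, hθ⟩
  have i2 : IntervalIntegrable (fun θ => radialDeriv2 U z s θ) volume 0 (2 * π) := by
    refine ContinuousOn.intervalIntegrable ?_
    rw [uIcc_of_le hpi]
    exact (continuousOn_radialDeriv2 hU).comp (f := fun θ => (s, θ))
        (by fun_prop) fun θ hθ => ⟨hs, hθ⟩
  have i3 : IntervalIntegrable (fun θ : ℝ => (fderiv ℝ (fderiv ℝ U) (circleMap z s θ)
      (s * (Complex.I * Complex.exp (θ * Complex.I)))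
      (s * (Complex.I * Complex.exp (θ * Complex.I)))
      - s * radialDeriv U z s θ)) volume 0 (2 * π) := by
    refine IntervalIntegrable.sub (ContinuousOn.intervalIntegrable ?_) (i1.const_mul s)
    refine ContinuousOn.clm_apply (ContinuousOn.clm_apply ?_ (by fun_prop)) (by fun_prop)
    exact (continuousOn_fderiv_fderiv hU).comp (continuous_circleMap z s).continuousOn
        fun θ _ => hm θ
  have h0 := integral_angular_eq_zero hU hs
  rw [← add_zero (s ^ 2 * (∫ θ in 0..2 * π, radialDeriv2 U z s θ) + _)]
  nth_rewrite 4 [← h0]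
  simp only [← intervalIntegral.integral_const_mul]
  rw [← intervalIntegral.integral_add (i2.const_mul _) (i1.const_mul _),
    ← intervalIntegral.integral_add ((i2.const_mul _).add (i1.const_mul _)) i3]
  refine intervalIntegral.integral_congr fun θ _ => ?_
  simp only [laplacian_eq_rotated _ θ, radialDeriv2]
  have : (s * (Complex.I * Complex.exp (θ * Complex.I)) : ℂ)
      = s • (Complex.I * Complex.exp (θ * Complex.I)) := by rw [Complex.real_smul]
  rw [this]
  simp only [map_smul, smul_apply, smul_eq_mul]
  ring

end CircleMean

/-- Integration in polar coordinates centred at `z`. -/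
lemma integral_eq_integral_circleMap {g : ℂ → ℝ} (hm : Measurable g) (hg : Integrable g) (z : ℂ) :
    ∫ w, g w = ∫ s in Ioi (0 : ℝ), s * ∫ θ in 0..2 * π, g (circleMap z s θ) := by
  have hs : ∀ p : ℝ × ℝ, z + Complex.polarCoord.symm p = circleMap z p.1 p.2 := fun p => by
    rw [Complex.polarCoord_symm_apply, circleMap, Complex.exp_mul_I]; simp
  have hT : MeasurableSet (Ioi (0 : ℝ) ×ˢ Ioo (-π) π) := measurableSet_Ioi.prod measurableSet_Ioo
  have hmeas : Measurable (fun p : ℝ × ℝ => p.1 * g (circleMap z p.1 p.2)) :=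
    measurable_fst.mul (hm.comp continuous_circleMap_uncurry.measurable)
  have hint : IntegrableOn (fun p : ℝ × ℝ => p.1 * g (circleMap z p.1 p.2))
      (Ioi (0 : ℝ) ×ˢ Ioo (-π) π) := by
    refine ⟨hmeas.aestronglyMeasurable, ?_⟩
    have h1 := Complex.lintegral_comp_polarCoord_symm (fun w => ‖g (z + w)‖ₑ)
    rw [HasFiniteIntegral]
    have h2 : ∫⁻ w, ‖g (z + w)‖ₑ < ∞ := (hg.comp_add_left z).2
    rw [← h1, polarCoord_target] at h2
    refine lt_of_le_of_lt (le_of_eq ?_) h2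
    refine setLIntegral_congr_fun hT fun p hp => ?_
    have hp1 : 0 < p.1 := hp.1
    simp only [hs, enorm_mul, smul_eq_mul]
    rw [Real.enorm_of_nonneg hp1.le]
  rw [← integral_add_left_eq_self g z, ← Complex.integral_comp_polarCoord_symm,
    polarCoord_target]
  simp only [hs, smul_eq_mul]
  rw [Measure.volume_eq_prod, setIntegral_prod _ hint]
  refine setIntegral_congr_fun measurableSet_Ioi fun s _ => ?_
  simp only
  rw [integral_const_mul]
  congr 1
  have hper : (fun θ => g (circleMap z s θ)).Periodic (2 * π) :=
    fun x => by simp [periodic_circleMap z s x]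
  have := hper.intervalIntegral_add_eq 0 (-π)
  rw [zero_add] at this
  rw [this, intervalIntegral.integral_of_le (by linarith [pi_pos]), integral_Ioc_eq_integral_Ioo]
  congr 2
  ring_nf

lemma setIntegral_ball_eq_integral_circleMap {g : ℂ → ℝ} {z : ℂ} {r : ℝ}
    (hm : Measurable ((ball z r).indicator g)) (hg : IntegrableOn g (ball z r)) (hr : 0 ≤ r) :
    ∫ w in ball z r, g w = ∫ s in 0..r, s * ∫ θ in 0..2 * π, g (circleMap z s θ) := by
  rw [← integral_indicator measurableSet_ball, integral_eq_integral_circleMap hm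
    ((integrable_indicator_iff measurableSet_ball).2 hg) z,
    intervalIntegral.integral_of_le hr, integral_Ioc_eq_integral_Ioo,
    ← integral_indicator measurableSet_Ioi, ← integral_indicator measurableSet_Ioo]
  congr 1
  ext s
  by_cases hs : 0 < s
  · by_cases hsr : s < r
    · rw [indicator_of_mem (show s ∈ Ioi 0 from hs),
        indicator_of_mem (show s ∈ Ioo 0 r from ⟨hs, hsr⟩)]
      congr 1
      refine intervalIntegral.integral_congr fun θ _ => ?_
      exact indicator_of_mem (circleMap_mem_ball_of_lt hs.le hsr θ) _
    · rw [indicator_of_mem (show s ∈ Ioi 0 from hs),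
        indicator_of_notMem (show s ∉ Ioo 0 r from fun h => hsr h.2)]
      have : ∀ θ, (ball z r).indicator g (circleMap z s θ) = 0 := fun θ => by
        refine indicator_of_notMem ?_ _
        rw [mem_ball, dist_eq_norm, circleMap_sub_center, norm_circleMap_zero, abs_of_pos hs]
        exact hsr
      simp [this]
  · rw [indicator_of_notMem (show s ∉ Ioi 0 from hs),
      indicator_of_notMem (show s ∉ Ioo 0 r from fun h => hs h.1)]

lemma integrableOn_norm_rpow_neg_ball {σ : ℝ} (hσ : σ < 2) (r : ℝ) :
    IntegrableOn (fun w : ℂ => ‖w‖ ^ (-σ)) (ball 0 r) := by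
  rcases le_or_gt r 0 with hr | hr
  · simp [ball_eq_empty.2 hr]
  rw [integrableOn_fun_norm_addHaar volume (f := fun t : ℝ => t ^ (-σ))]
  simp only [Complex.finrank_real_complex]
  have : IntegrableOn (fun t : ℝ => t ^ (1 - σ)) (Ioo 0 r) :=
    (intervalIntegral.integrableOn_Ioo_rpow_iff hr).2 (by linarith)
  refine this.congr_fun (fun t ht => ?_) measurableSet_Ioo
  have ht : 0 < t := ht.1
  simp only [smul_eq_mul]
  rw [sub_eq_add_neg, rpow_add ht]; simp

lemma continuousOn_integral_circleMap {g : ℂ → ℝ} {z : ℂ} {R : ℝ}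
    (hg : ContinuousOn g (ball z R)) :
    ContinuousOn (fun s => ∫ θ in 0..2 * π, g (circleMap z s θ)) (Ioo (-R) R) := by
  rw [continuousOn_iff_continuous_domRestrict] at *
  refine intervalIntegral.continuous_parametric_intervalIntegral_of_continuous' ?_ _ _
  exact hg.comp (f := fun p : Ioo (-R) R × ℝ => (⟨circleMap z p.1 p.2,
    circleMap_mem_ball_of_abs_lt (abs_lt.2 p.1.2) p.2⟩ : ball z R)) (by fun_prop)

lemma measurable_indicator_of_continuousOn {g : ℂ → ℝ} {s : Set ℂ} (hs : MeasurableSet s)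
    (hg : ContinuousOn g s) : Measurable (s.indicator g) := by
  classical
  rw [← piecewise_eq_indicator]
  exact hg.measurable_piecewise continuousOn_const hs

lemma log_div_norm_nonneg {r : ℝ} {w : ℂ} (hw : ‖w‖ ≤ r) :
    0 ≤ Real.log (r / ‖w‖) := by
  rcases eq_or_ne ‖w‖ 0 with h | h
  · simp [h]
  · exact Real.log_nonneg ((one_le_div (lt_of_le_of_ne (norm_nonneg w) h.symm)).2 hw)

lemma integrableOn_log_div_norm_sub (z : ℂ) (r : ℝ) :
    IntegrableOn (fun w : ℂ => Real.log (r / ‖w - z‖)) (ball z r) := by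
  have h1 : IntegrableOn (fun w : ℂ => Real.log (r / ‖w‖)) (ball 0 r) := by
    refine Integrable.mono' ((integrableOn_norm_rpow_neg_ball (σ := 1) (by norm_num) r).const_mul r)
      (Real.measurable_log.comp (measurable_const.div measurable_norm)).aestronglyMeasurable ?_
    filter_upwards [ae_restrict_mem measurableSet_ball] with w hw
    have hw : ‖w‖ < r := by simpa using hw
    rw [Real.norm_of_nonneg (log_div_norm_nonneg hw.le), rpow_neg_one, ← div_eq_mul_inv]
    exact Real.log_le_self (div_nonneg ((norm_nonneg w).trans hw.le) (norm_nonneg w))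
  rw [← integrable_indicator_iff measurableSet_ball] at h1 ⊢
  have := h1.comp_sub_right z
  refine this.congr (ae_of_all _ fun w => ?_)
  simp [indicator, dist_eq_norm]

/-- Jensen's formula for `C²` functions (Green's representation at the centre of a disc). -/
lemma eq_circleAverage_sub_integral_laplacian {U : ℂ → ℝ} {z : ℂ} {r R : ℝ}
    (hU : ContDiffOn ℝ 2 U (ball z R)) (hr : 0 < r) (hrR : r < R) :
    2 * π * U z = 2 * π * circleAverage U z r -
      ∫ w in ball z r, Real.log (r / ‖w - z‖) * Laplacian.laplacian U w := by
  have hR : 0 < R := hr.trans hrR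
  have hlap : ContinuousOn (Laplacian.laplacian U) (ball z R) := by
    have := continuousOn_fderiv_fderiv hU
    rw [InnerProductSpace.laplacian_eq_iteratedFDeriv_complexPlane]
    simp only [iteratedFDeriv_two_apply]
    fun_prop
  have hsub : Icc 0 r ⊆ Ioo (-R) R := fun s hs => ⟨by linarith [hs.1], by linarith [hs.2]⟩
  set A : ℝ → ℝ := fun s => ∫ θ in 0..2 * π, U (circleMap z s θ)
  set A' : ℝ → ℝ := fun s => ∫ θ in 0..2 * π, radialDeriv U z s θ
  set A'' : ℝ → ℝ := fun s => ∫ θ in 0..2 * π, radialDeriv2 U z s θ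
  set D : ℝ → ℝ := fun s => ∫ θ in 0..2 * π, Laplacian.laplacian U (circleMap z s θ)
  have hA : ∀ s ∈ Ioo (-R) R, HasDerivAt A (A' s) s := fun s hs =>
    hasDerivAt_integral_circleMap hU hs
  have hA' : ∀ s ∈ Ioo (-R) R, HasDerivAt A' (A'' s) s := fun s hs =>
    hasDerivAt_integral_radialDeriv hU hs
  have hD : ContinuousOn D (Ioo (-R) R) := continuousOn_integral_circleMap hlap
  have hΦ : ∀ s ∈ Ioo 0 r, HasDerivAt (fun s => A s + (s * Real.log r - s * Real.log s) * A' s)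
      (s * Real.log (r / s) * D s) s := by
    intro s hs
    have hs' := hsub (Ioo_subset_Icc_self hs)
    have h1 := (hA s hs').add ((((hasDerivAt_id s).mul_const (Real.log r)).sub
      (Real.hasDerivAt_mul_log hs.1.ne')).mul (hA' s hs'))
    refine h1.congr_deriv ?_
    have h2 := integral_laplacian_circleMap hU hs'
    have h3 : s * D s = s * A'' s + A' s :=
      mul_left_cancel₀ hs.1.ne' (by linear_combination h2)
    rw [Real.log_div hr.ne' hs.1.ne']
    simp only [Pi.sub_apply, id]
    linear_combination -(Real.log r - Real.log s) * h3
  have hFTC := intervalIntegral.integral_eq_sub_of_hasDerivAt_of_le hr.le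
    (f := fun s => A s + (s * Real.log r - s * Real.log s) * A' s) ?_ hΦ ?_
  · have hpol := setIntegral_ball_eq_integral_circleMap
      (g := fun w => Real.log (r / ‖w - z‖) * Laplacian.laplacian U w) (z := z) (r := r) ?_ ?_ hr.le
    · rw [hpol]
      have : ∫ s in 0..r, s * ∫ θ in 0..2 * π, (Real.log (r / ‖circleMap z s θ - z‖) *
          Laplacian.laplacian U (circleMap z s θ)) = ∫ s in 0..r, s * Real.log (r / s) * D s := by
        refine intervalIntegral.integral_congr fun s hs => ?_
        rw [uIcc_of_le hr.le] at hs
        simp only [circleMap_sub_center, norm_circleMap_zero, abs_of_nonneg hs.1,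
          intervalIntegral.integral_const_mul, D, mul_assoc]
      rw [this, hFTC]
      simp only [A, circleAverage_def, circleMap_zero_radius, smul_eq_mul]
      simp
      field_simp
      ring
    · have : (ball z r).indicator (fun w => Real.log (r / ‖w - z‖) * Laplacian.laplacian U w)
          = fun w => Real.log (r / ‖w - z‖) * (ball z r).indicator (Laplacian.laplacian U) w := by
        ext w; by_cases hw : w ∈ ball z r <;> simp [hw]
      rw [this]
      exact (Real.measurable_log.comp (measurable_const.div
        (measurable_id.sub_const z).norm)).mul (measurable_indicator_of_continuousOn
          measurableSet_ball (hlap.mono (ball_subset_ball hrR.le)))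
    · obtain ⟨C, hC⟩ := (isCompact_closedBall z r).exists_bound_of_continuousOn
        (hlap.mono (closedBall_subset_ball hrR))
      refine (integrableOn_log_div_norm_sub z r).mul_bdd
        ((hlap.mono (ball_subset_ball hrR.le)).aestronglyMeasurable measurableSet_ball) (c := C) ?_
      filter_upwards [ae_restrict_mem measurableSet_ball] with w hw
      exact hC w (ball_subset_closedBall hw)
  · have h1 : ContinuousOn A (Icc 0 r) := fun s hs =>
      (hA s (hsub hs)).continuousAt.continuousWithinAt
    have h2 : ContinuousOn A' (Icc 0 r) :=
      fun s hs => (hA' s (hsub hs)).continuousAt.continuousWithinAt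
    have h3 := Real.continuous_mul_log
    fun_prop
  · have h3 := Real.continuous_mul_log
    have h4 : ContinuousOn (fun s => (s * Real.log r - s * Real.log s) * D s) (Icc 0 r) := by
      have := hD.mono hsub
      fun_prop
    rw [← uIcc_of_le hr.le] at h4
    refine h4.intervalIntegrable.congr fun s hs => ?_
    rcases eq_or_ne s 0 with rfl | hs0
    · simp
    · rw [Real.log_div hr.ne' hs0]; ring

lemma abs_log_sub_log_le {γ a b : ℝ} (hγ : 0 < γ) (hγ1 : γ ≤ 1) (ha : 0 < a) (hb : 0 < b) :
    |Real.log a - Real.log b| ≤ γ⁻¹ * |a - b| ^ γ * (a ^ (-γ) + b ^ (-γ)) := by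
  wlog hab : a ≤ b generalizing a b
  · have := this hb ha (le_of_not_ge hab)
    rwa [abs_sub_comm, abs_sub_comm b, add_comm] at this
  have h0 : 0 ≤ b - a := by linarith
  rw [abs_sub_comm, abs_sub_comm a, abs_of_nonneg h0,
    abs_of_nonneg (by linarith [Real.log_le_log ha hab])]
  have h1 : b ^ γ ≤ a ^ γ + (b - a) ^ γ := by
    have := Real.rpow_add_le_add_rpow ha.le h0 hγ.le hγ1
    simpa using this
  have ha' : 0 < a ^ γ := rpow_pos_of_pos ha _
  have h2 : γ * (Real.log b - Real.log a) ≤ (b - a) ^ γ * a ^ (-γ) := by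
    have h3 := Real.log_le_sub_one_of_pos (div_pos (rpow_pos_of_pos hb γ) ha')
    rw [Real.log_div (rpow_pos_of_pos hb γ).ne' ha'.ne', Real.log_rpow hb, Real.log_rpow ha] at h3
    calc γ * (Real.log b - Real.log a) ≤ b ^ γ / a ^ γ - 1 := by linarith
      _ = (b ^ γ - a ^ γ) / a ^ γ := by field_simp
      _ ≤ (b - a) ^ γ / a ^ γ := by gcongr; linarith
      _ = _ := by rw [rpow_neg ha.le]; rfl
  have h4 : 0 ≤ (b - a) ^ γ * b ^ (-γ) := by positivity
  rw [mul_assoc, ← div_eq_inv_mul, le_div_iff₀ hγ]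
  linarith

/-- The logarithmic potential of the density `f`. -/
def logPotential (c : ℝ) (f : ℂ → ℝ) (x : ℂ) : ℝ := ∫ y, Real.log (c / ‖x - y‖) * f y

section RieszPotential
variable {f : ℂ → ℝ} {γ : ℝ}

lemma integrable_rpow_neg_mul (hfi : Integrable f) (hf0 : ∀ y, 0 ≤ f y) (hγ : 0 ≤ γ)
    (hγ2 : γ < 2) {x : ℂ} {ρ C : ℝ} (hρ : 0 < ρ) (hC : ∀ y ∈ ball x ρ, f y ≤ C) :
    Integrable (fun y => ‖x - y‖ ^ (-γ) * f y) ∧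
      ∫ y, ‖x - y‖ ^ (-γ) * f y ≤
        C * (∫ w in ball (0 : ℂ) ρ, ‖w‖ ^ (-γ)) + ρ ^ (-γ) * ∫ y, f y := by
  have h1 := (integrable_indicator_iff (measurableSet_ball (x := (0 : ℂ)))).2
    (integrableOn_norm_rpow_neg_ball hγ2 ρ)
  have h2 := (h1.comp_sub_left x).const_mul C
  have h3 := h2.add (hfi.const_mul (ρ ^ (-γ)))
  have hle : ∀ y, ‖x - y‖ ^ (-γ) * f y ≤
      C * (ball (0 : ℂ) ρ).indicator (fun w => ‖w‖ ^ (-γ)) (x - y) + ρ ^ (-γ) * f y := fun y => by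
    have hk : 0 ≤ ‖x - y‖ ^ (-γ) := by positivity
    have hk' : 0 ≤ ρ ^ (-γ) := by positivity
    by_cases hy : y ∈ ball x ρ
    · have hy' : x - y ∈ ball (0 : ℂ) ρ := by
        rw [mem_ball, dist_comm, dist_eq_norm] at hy; simpa using hy
      rw [indicator_of_mem hy']
      nlinarith [mul_le_mul_of_nonneg_left (hC y hy) hk, mul_nonneg hk' (hf0 y)]
    · have hy' : x - y ∉ ball (0 : ℂ) ρ := by
        rw [mem_ball, dist_comm, dist_eq_norm] at hy; simpa using hy
      rw [indicator_of_notMem hy', mul_zero, zero_add]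
      rw [mem_ball_zero_iff, not_lt] at hy'
      exact mul_le_mul_of_nonneg_right
        (rpow_le_rpow_of_nonpos hρ hy' (by linarith)) (hf0 y)
  have hint : Integrable (fun y => ‖x - y‖ ^ (-γ) * f y) := by
    refine h3.mono' (AEStronglyMeasurable.mul (Measurable.aestronglyMeasurable (by fun_prop))
      hfi.1) (ae_of_all _ fun y => ?_)
    rw [Real.norm_of_nonneg (mul_nonneg (by positivity) (hf0 y))]
    exact hle y
  refine ⟨hint, (integral_mono hint h3 hle).trans_eq ?_⟩
  simp only [Pi.add_apply]
  rw [integral_add h2 (hfi.const_mul _), integral_const_mul, integral_const_mul,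
    integral_sub_left_eq_self (fun w => (ball (0 : ℂ) ρ).indicator (fun w => ‖w‖ ^ (-γ)) w),
    integral_indicator measurableSet_ball]

variable {c R : ℝ}

lemma log_div_norm_sub_le {x y : ℂ} (hγ : 0 < γ) (hc : 0 ≤ c) :
    Real.log (c / ‖x - y‖) ≤ γ⁻¹ * c ^ γ * ‖x - y‖ ^ (-γ) := by
  have := Real.log_le_rpow_div (div_nonneg hc (norm_nonneg (x - y))) hγ
  rw [Real.div_rpow hc (norm_nonneg _)] at this
  rw [rpow_neg (norm_nonneg _)]
  convert this using 1
  field_simp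

lemma log_div_mul_nonneg (hf0 : ∀ y, 0 ≤ f y) (hfs : ∀ y, y ∉ ball 0 R → f y = 0)
    (hc : 2 * R ≤ c) {x : ℂ} (hx : x ∈ ball 0 R) (y : ℂ) :
    0 ≤ Real.log (c / ‖x - y‖) * f y := by
  by_cases hy : y ∈ ball 0 R
  · refine mul_nonneg (log_div_norm_nonneg ?_) (hf0 y)
    have := norm_sub_le x y
    rw [mem_ball_zero_iff] at hx hy
    linarith
  · simp [hfs y hy]

lemma abs_log_div_mul_le (hf0 : ∀ y, 0 ≤ f y) (hfs : ∀ y, y ∉ ball 0 R → f y = 0)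
    (hR : 0 < R) (hc : 2 * R ≤ c) (hγ : 0 < γ) {x : ℂ} (hx : x ∈ ball 0 R) (y : ℂ) :
    ‖Real.log (c / ‖x - y‖) * f y‖ ≤ γ⁻¹ * c ^ γ * (‖x - y‖ ^ (-γ) * f y) := by
  rw [Real.norm_of_nonneg (log_div_mul_nonneg hf0 hfs hc hx y), ← mul_assoc]
  exact mul_le_mul_of_nonneg_right (log_div_norm_sub_le hγ (by linarith)) (hf0 y)

lemma measurable_log_div_norm_sub :
    Measurable (fun p : ℂ × ℂ => Real.log (c / ‖p.1 - p.2‖)) :=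
  Real.measurable_log.comp (measurable_const.div (measurable_fst.sub measurable_snd).norm)

lemma integrable_log_div_mul (hfi : Integrable f) (hf0 : ∀ y, 0 ≤ f y)
    (hfs : ∀ y, y ∉ ball 0 R → f y = 0)
    (hR : 0 < R) (hc : 2 * R ≤ c) (hγ : 0 < γ) {x : ℂ} (hx : x ∈ ball 0 R)
    (hi : Integrable (fun y => ‖x - y‖ ^ (-γ) * f y)) :
    Integrable (fun y => Real.log (c / ‖x - y‖) * f y) := by
  refine (hi.const_mul (γ⁻¹ * c ^ γ)).mono' ?_
    (ae_of_all _ (abs_log_div_mul_le hf0 hfs hR hc hγ hx))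
  exact (measurable_log_div_norm_sub.comp
    (measurable_const.prodMk measurable_id)).aestronglyMeasurable.mul hfi.1

lemma logPotential_nonneg (hf0 : ∀ y, 0 ≤ f y) (hfs : ∀ y, y ∉ ball 0 R → f y = 0)
    (hc : 2 * R ≤ c) {x : ℂ} (hx : x ∈ ball 0 R) : 0 ≤ logPotential c f x :=
  integral_nonneg (log_div_mul_nonneg hf0 hfs hc hx)

/-- A uniform bound on a Riesz potential makes the logarithmic potential Hölder continuous. -/
lemma abs_logPotential_sub_le (hfi : Integrable f) (hf0 : ∀ y, 0 ≤ f y)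
    (hfs : ∀ y, y ∉ ball 0 R → f y = 0)
    (hR : 0 < R) (hc : 2 * R ≤ c) (hγ : 0 < γ) (hγ1 : γ ≤ 1) {x x' : ℂ}
    (hx : x ∈ ball 0 R) (hx' : x' ∈ ball 0 R) {S : ℝ}
    (hi : Integrable (fun y => ‖x - y‖ ^ (-γ) * f y))
    (hi' : Integrable (fun y => ‖x' - y‖ ^ (-γ) * f y))
    (hS : ∫ y, ‖x - y‖ ^ (-γ) * f y ≤ S) (hS' : ∫ y, ‖x' - y‖ ^ (-γ) * f y ≤ S) :
    |logPotential c f x - logPotential c f x'| ≤ 2 * γ⁻¹ * S * ‖x - x'‖ ^ γ := by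
  have h1 := integrable_log_div_mul hfi hf0 hfs hR hc hγ hx hi
  have h2 := integrable_log_div_mul hfi hf0 hfs hR hc hγ hx' hi'
  rw [logPotential, logPotential, ← integral_sub h1 h2]
  have hne : ∀ a : ℂ, ∀ᵐ y : ℂ, y ≠ a := fun a => by simp [ae_iff]
  have h3 : ∀ᵐ y, ‖Real.log (c / ‖x - y‖) * f y - Real.log (c / ‖x' - y‖) * f y‖ ≤
      (γ⁻¹ * ‖x - x'‖ ^ γ) * (‖x - y‖ ^ (-γ) * f y + ‖x' - y‖ ^ (-γ) * f y) := by
    filter_upwards [hne x, hne x'] with y hy hy'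
    have p1 : 0 < ‖x - y‖ := norm_pos_iff.2 (sub_ne_zero.2 hy.symm)
    have p2 : 0 < ‖x' - y‖ := norm_pos_iff.2 (sub_ne_zero.2 hy'.symm)
    have hc0 : 0 < c := by linarith
    rw [← sub_mul, Real.log_div hc0.ne' p1.ne', Real.log_div hc0.ne' p2.ne', norm_mul,
      Real.norm_of_nonneg (hf0 y), ← add_mul, ← mul_assoc]
    refine mul_le_mul_of_nonneg_right ?_ (hf0 y)
    rw [sub_sub_sub_cancel_left, Real.norm_eq_abs, abs_sub_comm]
    refine (abs_log_sub_log_le hγ hγ1 p1 p2).trans ?_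
    gcongr
    have := abs_norm_sub_norm_le (x - y) (x' - y)
    rwa [sub_sub_sub_cancel_right] at this
  refine (norm_integral_le_of_norm_le ((hi.add hi').const_mul _) h3).trans ?_
  simp only [Pi.add_apply]
  rw [integral_const_mul, integral_add hi hi']
  have : 0 ≤ γ⁻¹ * ‖x - x'‖ ^ γ := by positivity
  calc _ ≤ γ⁻¹ * ‖x - x'‖ ^ γ * (S + S) := by gcongr
    _ = _ := by ring

end RieszPotential

section PotentialAwayFromZero
variable {f : ℂ → ℝ} {γ c R : ℝ}

lemma exists_bound_rpow_neg_mul (hfi : Integrable f) (hf0 : ∀ y, 0 ≤ f y)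
    (hloc : ∀ ρ > 0, ∃ C, ∀ y, ρ ≤ ‖y‖ → f y ≤ C) (hγ : 0 ≤ γ) (hγ2 : γ < 2) {ρ : ℝ}
    (hρ : 0 < ρ) : ∃ S, ∀ x : ℂ, ρ ≤ ‖x‖ → Integrable (fun y => ‖x - y‖ ^ (-γ) * f y) ∧
      ∫ y, ‖x - y‖ ^ (-γ) * f y ≤ S := by
  obtain ⟨C, hC⟩ := hloc (ρ / 2) (by positivity)
  refine ⟨_, fun x hx => integrable_rpow_neg_mul hfi hf0 hγ hγ2 (half_pos hρ)
    fun y hy => hC y ?_⟩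
  rw [mem_ball, dist_comm, dist_eq_norm] at hy
  linarith [norm_sub_norm_le x y]

lemma continuousOn_logPotential (hfi : Integrable f) (hf0 : ∀ y, 0 ≤ f y)
    (hfs : ∀ y, y ∉ ball 0 R → f y = 0) (hloc : ∀ ρ > 0, ∃ C, ∀ y, ρ ≤ ‖y‖ → f y ≤ C)
    (hR : 0 < R) (hc : 2 * R ≤ c) : ContinuousOn (logPotential c f) (ball 0 R \ {0}) := by
  intro x hx
  have hx0 : 0 < ‖x‖ := norm_pos_iff.2 hx.2
  obtain ⟨S, hS⟩ := exists_bound_rpow_neg_mul hfi hf0 hloc zero_le_one one_lt_two (half_pos hx0)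
  rw [ContinuousWithinAt, tendsto_iff_norm_sub_tendsto_zero]
  have hlim : Filter.Tendsto (fun w => 2 * 1⁻¹ * S * ‖w - x‖ ^ (1 : ℝ))
      (nhdsWithin x (ball 0 R \ {0})) (nhds 0) := by
    have : Continuous (fun w : ℂ => 2 * 1⁻¹ * S * ‖w - x‖ ^ (1 : ℝ)) := by
      simp only [rpow_one]; fun_prop
    simpa using (this.tendsto x).mono_left nhdsWithin_le_nhds
  have hev : ∀ᶠ w in nhdsWithin x (ball 0 R \ {0}), ‖x‖ / 2 ≤ ‖w‖ :=
    nhdsWithin_le_nhds ((continuous_norm.tendsto x).eventually (le_mem_nhds (by linarith)))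
  refine squeeze_zero' (Filter.Eventually.of_forall fun _ => norm_nonneg _) ?_ hlim
  filter_upwards [hev, self_mem_nhdsWithin] with w hw hw'
  exact abs_logPotential_sub_le hfi hf0 hfs hR hc one_pos le_rfl hw'.1 hx.1 (hS w hw).1
    (hS x (by linarith)).1 (hS w hw).2 (hS x (by linarith)).2

lemma circleAverage_log_div_norm_sub {z y : ℂ} {r : ℝ} (hc : 0 < c) (hr : 0 < r) (hyz : y ≠ z)
    (hy : y ∉ sphere z r) :
    Real.log (c / ‖z - y‖) - circleAverage (fun w => Real.log (c / ‖w - y‖)) z r =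
      (ball z r).indicator (fun y => Real.log (r / ‖y - z‖)) y := by
  have h1 : circleAverage (fun w => Real.log (c / ‖w - y‖)) z r =
      circleAverage (fun w => Real.log c - Real.log ‖w - y‖) z r := by
    refine circleAverage_congr_sphere fun w hw => ?_
    rw [abs_of_pos hr] at hw
    have : ‖w - y‖ ≠ 0 := norm_ne_zero_iff.2 (sub_ne_zero.2 (by rintro rfl; exact hy hw))
    exact Real.log_div hc.ne' this
  have hzy : 0 < ‖z - y‖ := norm_pos_iff.2 (sub_ne_zero.2 hyz.symm)
  rw [h1, circleAverage_fun_sub (circleIntegrable_const _ _ _)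
    (circleIntegrable_log_norm_sub_const r), circleAverage_const,
    circleAverage_log_norm_sub_const_eq_log_radius_add_posLog hr.ne',
    Real.log_div hc.ne' hzy.ne']
  have habs : |r⁻¹ * ‖z - y‖| = r⁻¹ * ‖z - y‖ := abs_of_nonneg (by positivity)
  by_cases hb : y ∈ ball z r
  · rw [indicator_of_mem hb, norm_sub_rev y z, Real.log_div hr.ne' hzy.ne']
    rw [mem_ball, dist_comm, dist_eq_norm] at hb
    rw [(posLog_eq_zero_iff _).2]
    · ring
    · rw [habs, inv_mul_le_iff₀ hr]; linarith
  · rw [indicator_of_notMem hb]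
    rw [mem_ball, dist_comm, dist_eq_norm, not_lt] at hb
    rw [posLog_eq_log, Real.log_mul (by positivity) hzy.ne', Real.log_inv]
    · ring
    · rw [habs, le_inv_mul_iff₀ hr]; linarith

lemma logPotential_sub_circleAverage (hfi : Integrable f) (hf0 : ∀ y, 0 ≤ f y)
    (hfs : ∀ y, y ∉ ball 0 R → f y = 0) (hloc : ∀ ρ > 0, ∃ C, ∀ y, ρ ≤ ‖y‖ → f y ≤ C)
    (hR : 0 < R) (hc : 2 * R ≤ c) {z : ℂ} {r : ℝ} (hr : 0 < r)
    (hzr : closedBall z r ⊆ ball 0 R \ {0}) :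
    logPotential c f z - circleAverage (logPotential c f) z r =
      ∫ y in ball z r, Real.log (r / ‖y - z‖) * f y := by
  have hc0 : 0 < c := by linarith
  have hzr' : r < ‖z‖ := by
    have : (0 : ℂ) ∉ closedBall z r := fun h => (hzr h).2 rfl
    rwa [mem_closedBall, dist_zero_left, not_le] at this
  obtain ⟨S, hS⟩ := exists_bound_rpow_neg_mul hfi hf0 hloc zero_le_one one_lt_two
    (sub_pos.2 hzr')
  have hmem : ∀ θ, circleMap z r θ ∈ closedBall z r := fun θ =>
    circleMap_mem_closedBall z hr.le θ
  have hnorm : ∀ w ∈ closedBall z r, ‖z‖ - r ≤ ‖w‖ := fun w hw => by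
    rw [mem_closedBall, dist_comm, dist_eq_norm] at hw
    linarith [norm_sub_norm_le z w]
  have hSθ := fun θ => hS _ (hnorm _ (hmem θ))
  have hIθ := fun θ => integrable_log_div_mul hfi hf0 hfs hR hc one_pos (hzr (hmem θ)).1 (hSθ θ).1
  set μ : Measure ℝ := volume.restrict (Ioc 0 (2 * π))
  have hm : AEStronglyMeasurable (fun p : ℝ × ℂ =>
      Real.log (c / ‖circleMap z r p.1 - p.2‖) * f p.2) (μ.prod volume) := by
    refine AEStronglyMeasurable.mul (Measurable.aestronglyMeasurable ?_) hfi.1.comp_snd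
    exact measurable_log_div_norm_sub.comp
      (((continuous_circleMap z r).measurable.comp measurable_fst).prodMk measurable_snd)
  have hprod : Integrable (fun p : ℝ × ℂ =>
      Real.log (c / ‖circleMap z r p.1 - p.2‖) * f p.2) (μ.prod volume) := by
    rw [integrable_prod_iff hm]
    refine ⟨ae_of_all _ hIθ, ?_⟩
    refine Integrable.mono' (integrable_const ((1 : ℝ)⁻¹ * c ^ (1 : ℝ) * S))
      hm.norm.integral_prod_right' (ae_of_all _ fun θ => ?_)
    rw [Real.norm_of_nonneg (integral_nonneg fun _ => norm_nonneg _)]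
    refine (integral_mono (hIθ θ).norm ((hSθ θ).1.const_mul ((1 : ℝ)⁻¹ * c ^ (1 : ℝ)))
      (abs_log_div_mul_le hf0 hfs hR hc one_pos (hzr (hmem θ)).1)).trans ?_
    rw [integral_const_mul]
    exact mul_le_mul_of_nonneg_left (hSθ θ).2 (by positivity)
  have hzm : z ∈ closedBall z r := mem_closedBall_self hr.le
  have hIz := integrable_log_div_mul hfi hf0 hfs hR hc one_pos (hzr hzm).1
    (hS z (hnorm z hzm)).1
  have havg : ∀ y, (2 * π)⁻¹ * ∫ θ, Real.log (c / ‖circleMap z r θ - y‖) * f y ∂μ =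
      circleAverage (fun w => Real.log (c / ‖w - y‖)) z r * f y := fun y => by
    rw [integral_mul_const, circleAverage_def, smul_eq_mul,
      intervalIntegral.integral_of_le two_pi_pos.le, mul_assoc]
  have h1 : circleAverage (logPotential c f) z r =
      ∫ y, circleAverage (fun w => Real.log (c / ‖w - y‖)) z r * f y := by
    simp only [← havg]
    rw [integral_const_mul, ← integral_integral_swap hprod, circleAverage_def, smul_eq_mul,
      intervalIntegral.integral_of_le two_pi_pos.le]
    rfl
  have hI2 : Integrable (fun y => circleAverage (fun w => Real.log (c / ‖w - y‖)) z r * f y) := by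
    simp only [← havg]
    exact hprod.integral_prod_right.const_mul _
  rw [h1, logPotential, ← integral_sub hIz hI2, ← integral_indicator measurableSet_ball]
  refine integral_congr_ae ?_
  have a1 : ∀ᵐ y : ℂ, y ≠ z := by simp [ae_iff]
  have a2 : ∀ᵐ y : ℂ, y ∉ sphere z r :=
    measure_eq_zero_iff_ae_notMem.1 (Measure.addHaar_sphere volume z r)
  filter_upwards [a1, a2] with y h1 h2
  rw [← sub_mul, circleAverage_log_div_norm_sub hc0 hr h1 h2]
  by_cases hb : y ∈ ball z r <;> simp [hb]

/-- Subtracting the logarithmic potential of `-Δu` leaves a function with the mean value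
property. -/
lemma sub_logPotential_eq_circleAverage {u : ℂ → ℝ} (hu : ContDiffOn ℝ 2 u (ball 0 R \ {0}))
    (hΔ : ∀ w ∈ ball 0 R \ {0}, f w = -Laplacian.laplacian u w)
    (hfi : Integrable f) (hf0 : ∀ y, 0 ≤ f y)
    (hfs : ∀ y, y ∉ ball 0 R → f y = 0) (hloc : ∀ ρ > 0, ∃ C, ∀ y, ρ ≤ ‖y‖ → f y ≤ C)
    (hR : 0 < R) (hc : 2 * R ≤ c) {z : ℂ} {r : ℝ} (hr : 0 < r)
    (hzr : closedBall z r ⊆ ball 0 R \ {0}) :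
    circleAverage (fun w => 2 * π * u w - logPotential c f w) z r =
      2 * π * u z - logPotential c f z := by
  have hopen : IsOpen (ball (0 : ℂ) R \ {0}) := isOpen_ball.sdiff isClosed_singleton
  obtain ⟨δ, hδ, hthick⟩ := (isCompact_closedBall z r).exists_cthickening_subset_open hopen hzr
  have hsub : ball z (r + δ) ⊆ ball 0 R \ {0} := by
    refine ball_subset_closedBall.trans (Subset.trans ?_ hthick)
    rw [cthickening_closedBall hδ.le hr.le, add_comm]
  have hsph : sphere z |r| ⊆ ball 0 R \ {0} := by
    rw [abs_of_pos hr]; exact sphere_subset_closedBall.trans hzr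
  have c1 : CircleIntegrable u z r :=
    (hu.continuousOn.mono hsph).circleIntegrable'
  have c2 : CircleIntegrable (logPotential c f) z r :=
    ((continuousOn_logPotential hfi hf0 hfs hloc hR hc).mono hsph).circleIntegrable'
  have h1 := eq_circleAverage_sub_integral_laplacian (hu.mono hsub) hr (by linarith : r < r + δ)
  have h2 := logPotential_sub_circleAverage hfi hf0 hfs hloc hR hc hr hzr
  have h3 : ∫ y in ball z r, Real.log (r / ‖y - z‖) * f y =
      -∫ w in ball z r, Real.log (r / ‖w - z‖) * Laplacian.laplacian u w := by
    rw [← integral_neg]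
    refine setIntegral_congr_fun measurableSet_ball fun w hw => ?_
    rw [hΔ w (hzr (ball_subset_closedBall hw))]; ring
  have h4 : circleAverage (fun w => 2 * π * u w) z r = 2 * π * circleAverage u z r :=
    circleAverage_fun_smul (a := 2 * π) (f := u)
  have c1' : CircleIntegrable (fun w => 2 * π * u w) z r :=
    (continuousOn_const.mul (hu.continuousOn.mono hsph)).circleIntegrable'
  rw [circleAverage_fun_sub c1' c2, h4]
  linarith

end PotentialAwayFromZero

section MeanValueProperty
variable {h : ℂ → ℝ} {Ω : Set ℂ}

lemma contDiffOn_of_circleAverage_eq (hc : ContinuousOn h Ω)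
    (hmv : ∀ z r, 0 < r → closedBall z r ⊆ Ω → circleAverage h z r = h z) {z₀ : ℂ} {ρ : ℝ}
    (hρ : 0 < ρ) (hball : closedBall z₀ (2 * ρ) ⊆ Ω) : ContDiffOn ℝ 2 h (ball z₀ ρ) := by
  set φ : ℂ → ℝ := fun w => expNegInvGlue (ρ ^ 2 - ‖w‖ ^ 2) with hφ
  set g : ℂ → ℝ := (ball z₀ (2 * ρ)).indicator h with hg
  have hφd : ContDiff ℝ 2 φ := (expNegInvGlue.contDiff (n := 2)).comp
    (contDiff_const.sub (contDiff_norm_sq ℝ))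
  have hφ0 : ∀ w, ρ ≤ ‖w‖ → φ w = 0 := fun w hw =>
    expNegInvGlue.zero_of_nonpos (by nlinarith)
  have hφs : HasCompactSupport φ :=
    HasCompactSupport.intro (isCompact_closedBall 0 ρ) fun w hw => hφ0 w (by
      rw [mem_closedBall_zero_iff, not_le] at hw; exact hw.le)
  have hch : ContinuousOn h (ball z₀ (2 * ρ)) := hc.mono (ball_subset_closedBall.trans hball)
  have hgm : Measurable g := measurable_indicator_of_continuousOn measurableSet_ball hch
  have hgi : Integrable g := by
    rw [hg, integrable_indicator_iff measurableSet_ball]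
    exact ((hc.mono hball).integrableOn_compact (isCompact_closedBall _ _)).mono_set
      ball_subset_closedBall
  have hφb : ∀ w, ‖φ w‖ ≤ φ 0 := fun w => by
    rw [Real.norm_of_nonneg (expNegInvGlue.nonneg _)]
    exact expNegInvGlue.monotone (by simp)
  have hφi : Integrable φ := hφd.continuous.integrable_of_hasCompactSupport hφs
  set κ : ℝ := ∫ s in Ioi (0 : ℝ), s * (expNegInvGlue (ρ ^ 2 - s ^ 2) * (2 * π)) with hκ
  have hκpos : 0 < κ := by
    have h1 := integral_eq_integral_circleMap hφd.continuous.measurable hφi 0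
    have h2 : κ = ∫ w, φ w := by
      rw [h1]
      refine setIntegral_congr_fun measurableSet_Ioi fun s _ => ?_
      simp [φ, norm_circleMap_zero, mul_comm]
    rw [h2]
    refine hφd.continuous.integral_pos_of_hasCompactSupport_nonneg_nonzero hφs
      (fun w => expNegInvGlue.nonneg _) (x := 0) ?_
    exact (expNegInvGlue.pos_of_pos (by simp; positivity)).ne'
  have hconv : ContDiff ℝ 2 (convolution g φ (ContinuousLinearMap.mul ℝ ℝ) volume) :=
    hφs.contDiff_convolution_right (n := 2) _ hgi.locallyIntegrable hφd
  refine (hconv.contDiffOn.const_smul κ⁻¹).congr fun x hx => ?_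
  have hval : convolution g φ (ContinuousLinearMap.mul ℝ ℝ) volume x = κ * h x := by
    rw [convolution_def]
    simp only [ContinuousLinearMap.mul_apply']
    have hm : Measurable fun t => g t * φ (x - t) :=
      hgm.mul (hφd.continuous.measurable.comp (measurable_const.sub measurable_id))
    have hi : Integrable fun t => g t * φ (x - t) :=
      hgi.mul_bdd (Measurable.aestronglyMeasurable
        (hφd.continuous.measurable.comp (measurable_const.sub measurable_id)))
        (ae_of_all _ fun t => hφb (x - t))
    rw [integral_eq_integral_circleMap hm hi x, hκ, ← integral_mul_const]
    refine setIntegral_congr_fun measurableSet_Ioi fun s hs => ?_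
    have hs : 0 < s := hs
    have hφc : ∀ θ, φ (x - circleMap x s θ) = expNegInvGlue (ρ ^ 2 - s ^ 2) := fun θ => by
      simp only [φ]
      rw [norm_sub_rev, circleMap_sub_center, norm_circleMap_zero, sq_abs]
    simp only [hφc, intervalIntegral.integral_mul_const]
    rcases le_or_gt ρ s with hsρ | hsρ
    · rw [expNegInvGlue.zero_of_nonpos (by nlinarith)]; simp
    · have hsub : closedBall x s ⊆ ball z₀ (2 * ρ) := by
        intro w hw
        rw [mem_ball] at hx ⊢
        rw [mem_closedBall] at hw
        linarith [dist_triangle w x z₀]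
      have h1 := hmv x s hs (hsub.trans (ball_subset_closedBall.trans hball))
      rw [circleAverage_def, smul_eq_mul, inv_mul_eq_iff_eq_mul₀ two_pi_pos.ne'] at h1
      have h2 : ∫ θ in 0..2 * π, g (circleMap x s θ) = ∫ θ in 0..2 * π, h (circleMap x s θ) :=
        intervalIntegral.integral_congr fun θ _ =>
          indicator_of_mem (hsub (circleMap_mem_closedBall x hs.le θ)) _
      rw [h2, h1]; ring
  simp only [smul_eq_mul]
  rw [hval]
  field_simp

lemma laplacian_nonpos_of_circleAverage_eq {z : ℂ} {ρ : ℝ} (hρ : 0 < ρ)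
    (hd : ContDiffOn ℝ 2 h (ball z ρ))
    (hmv : ∀ r, 0 < r → r < ρ → circleAverage h z r = h z) : Laplacian.laplacian h z ≤ 0 := by
  by_contra! hpos
  have hlap : ContinuousOn (Laplacian.laplacian h) (ball z ρ) := by
    have := continuousOn_fderiv_fderiv hd
    rw [InnerProductSpace.laplacian_eq_iteratedFDeriv_complexPlane]
    simp only [iteratedFDeriv_two_apply]
    fun_prop
  have hev := (hlap.continuousAt (ball_mem_nhds z hρ)).eventually (lt_mem_nhds hpos)
  obtain ⟨δ, hδ, hδ'⟩ := Metric.eventually_nhds_iff_ball.1 hev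
  set r := min (δ / 2) (ρ / 2) with hr_def
  have hr : 0 < r := by positivity
  have hrδ : r < δ := (min_le_left _ _).trans_lt (half_lt_self hδ)
  have hrρ : r < ρ := (min_le_right _ _).trans_lt (half_lt_self hρ)
  have h1 := eq_circleAverage_sub_integral_laplacian hd hr hrρ
  rw [hmv r hr hrρ] at h1
  have hcl := hlap.mono (closedBall_subset_ball hrρ)
  obtain ⟨C, hC⟩ := (isCompact_closedBall z r).exists_bound_of_continuousOn hcl
  have hint : IntegrableOn (fun w => Real.log (r / ‖w - z‖) * Laplacian.laplacian h w)
      (ball z r) := by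
    refine (integrableOn_log_div_norm_sub z r).mul_bdd
      ((hcl.mono ball_subset_closedBall).aestronglyMeasurable measurableSet_ball) (c := C) ?_
    filter_upwards [ae_restrict_mem measurableSet_ball] with w hw
    exact hC w (ball_subset_closedBall hw)
  have hnn : ∀ w ∈ ball z r, 0 ≤ Real.log (r / ‖w - z‖) * Laplacian.laplacian h w := fun w hw =>
    mul_nonneg (log_div_norm_nonneg (mem_ball_iff_norm.1 hw).le)
      (hδ' w (ball_subset_ball hrδ.le hw)).le
  have h2 : 0 < ∫ w in ball z r, Real.log (r / ‖w - z‖) * Laplacian.laplacian h w := by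
    rw [setIntegral_pos_iff_support_of_nonneg_ae
      (by filter_upwards [ae_restrict_mem measurableSet_ball] with w hw using hnn w hw) hint]
    have hsub : ball z r \ {z} ⊆ Function.support (fun w => Real.log (r / ‖w - z‖) *
        Laplacian.laplacian h w) ∩ ball z r := by
      rintro w ⟨hw, hwz⟩
      refine ⟨(mul_pos (Real.log_pos ?_) (hδ' w (ball_subset_ball hrδ.le hw))).ne', hw⟩
      rw [one_lt_div (norm_pos_iff.2 (sub_ne_zero.2 hwz))]
      exact mem_ball_iff_norm.1 hw
    refine lt_of_lt_of_le ?_ (measure_mono hsub)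
    rw [measure_sdiff_null (measure_singleton z)]
    exact measure_ball_pos volume z hr
  linarith

/-- A continuous function with the mean value property is harmonic. -/
lemma harmonicOnNhd_of_circleAverage_eq (hΩ : IsOpen Ω) (hc : ContinuousOn h Ω)
    (hmv : ∀ z r, 0 < r → closedBall z r ⊆ Ω → circleAverage h z r = h z) :
    InnerProductSpace.HarmonicOnNhd h Ω := by
  have hloc : ∀ z ∈ Ω, ∃ ρ > 0, closedBall z ρ ⊆ Ω ∧ ContDiffOn ℝ 2 h (ball z ρ) := by
    intro z hz
    obtain ⟨ε, hε, hsub⟩ := Metric.isOpen_iff.1 hΩ z hz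
    have hb : closedBall z (2 * (ε / 4)) ⊆ Ω :=
      (closedBall_subset_ball (by linarith)).trans hsub
    exact ⟨ε / 4, by positivity, (closedBall_subset_closedBall (by linarith)).trans hb,
      contDiffOn_of_circleAverage_eq hc hmv (by positivity) hb⟩
  have hlap : ∀ z ∈ Ω, Laplacian.laplacian h z = 0 := by
    intro z hz
    obtain ⟨ρ, hρ, hsub, hd⟩ := hloc z hz
    have hm : ∀ r, 0 < r → r < ρ → circleAverage h z r = h z := fun r hr hrρ =>
      hmv z r hr ((closedBall_subset_closedBall hrρ.le).trans hsub)
    refine le_antisymm (laplacian_nonpos_of_circleAverage_eq hρ hd hm) ?_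
    have h2 := laplacian_nonpos_of_circleAverage_eq (h := -h) hρ hd.neg fun r hr hrρ => by
      have h3 := hm r hr hrρ
      rw [circleAverage_def] at h3 ⊢
      simpa using h3
    rw [InnerProductSpace.laplacian_neg] at h2
    simpa using h2
  intro z hz
  obtain ⟨ρ, hρ, hsub, hd⟩ := hloc z hz
  refine ⟨hd.contDiffAt (ball_mem_nhds z hρ), ?_⟩
  filter_upwards [hΩ.mem_nhds hz] with w hw using hlap w hw

end MeanValueProperty

section Bocher
variable {h : ℂ → ℝ} {R : ℝ}

/-- A harmonic function on a punctured disc is, up to a multiple of `log ‖w‖`, the logarithm of the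
modulus of a holomorphic function. -/
lemma exists_norm_eq_exp_sub_log (hR : 0 < R)
    (hh : InnerProductSpace.HarmonicOnNhd h (ball 0 R \ {0})) :
    ∃ (a : ℝ) (E : ℂ → ℂ), DifferentiableOn ℂ E (ball 0 R \ {0}) ∧
      ∀ w ∈ ball (0 : ℂ) R \ {0}, ‖E w‖ = Real.exp (h w - a * Real.log ‖w‖) := by
  set P : Set ℂ := {ζ | ζ.re < Real.log R} with hP
  have hPo : IsOpen P := isOpen_lt Complex.continuous_re continuous_const
  have hPc : Convex ℝ P := convex_halfSpace_re_lt _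
  have hexp : ∀ ζ ∈ P, Complex.exp ζ ∈ ball (0 : ℂ) R \ {0} := fun ζ hζ => by
    refine ⟨?_, Complex.exp_ne_zero ζ⟩
    rw [mem_ball_zero_iff, Complex.norm_exp]
    exact (Real.lt_log_iff_exp_lt hR).1 hζ
  set G : ℂ → ℂ := fun z => fderiv ℝ h z 1 - Complex.I * fderiv ℝ h z Complex.I with hG
  have hGd : ∀ z ∈ ball (0 : ℂ) R \ {0}, DifferentiableAt ℂ G z := fun z hz =>
    HarmonicAt.differentiableAt_complex_partial (hh z hz)
  have hkd : DifferentiableOn ℂ (fun ζ => G (Complex.exp ζ) * Complex.exp ζ) P := fun ζ hζ =>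
    (((hGd _ (hexp ζ hζ)).comp ζ Complex.differentiableAt_exp).mul
      Complex.differentiableAt_exp).differentiableWithinAt
  obtain ⟨F, hF⟩ := hPc.exists_forall_hasDerivWithinAt hkd
  have hF' : ∀ ζ ∈ P, HasDerivAt F (G (Complex.exp ζ) * Complex.exp ζ) ζ := fun ζ hζ =>
    (hF ζ hζ).hasDerivAt (hPo.mem_nhds hζ)
  have hre : ∃ a : ℝ, ∀ ζ ∈ P, h (Complex.exp ζ) - (F ζ).re = a := by
    have hder : ∀ ζ ∈ P, HasFDerivAt (fun ζ => h (Complex.exp ζ) - (F ζ).re) (0 : ℂ →L[ℝ] ℝ) ζ := by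
      intro ζ hζ
      have h1 : HasFDerivAt h (fderiv ℝ h (Complex.exp ζ)) (Complex.exp ζ) :=
        ((hh _ (hexp ζ hζ)).1.differentiableAt (by norm_num)).hasFDerivAt
      have h2 := h1.comp ζ ((Complex.hasDerivAt_exp ζ).hasFDerivAt.restrictScalars ℝ)
      have h3 := Complex.reCLM.hasFDerivAt.comp ζ ((hF' ζ hζ).hasFDerivAt.restrictScalars ℝ)
      refine (h2.sub h3).congr_fderiv ?_
      ext v
      have hv : ∀ L : ℂ →L[ℝ] ℝ, ∀ w : ℂ, L w = w.re * L 1 + w.im * L Complex.I := fun L w => by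
        conv_lhs => rw [← Complex.re_add_im w, mul_comm]
        rw [map_add]
        have e1 : L (w.re : ℂ) = w.re * L 1 := by
          rw [← smul_eq_mul, ← map_smul]; simp
        have e2 : L (Complex.I * w.im) = w.im * L Complex.I := by
          rw [← smul_eq_mul (a := w.im), ← map_smul]; simp [mul_comm]
        rw [e1, e2]
      simp only [sub_apply, ContinuousLinearMap.comp_apply,
        zero_apply]
      rw [hv (fderiv ℝ h (Complex.exp ζ))]
      simp [hG]
      ring
    obtain ⟨a, ha⟩ := hPo.exists_is_const_of_fderiv_eq_zero hPc.isPreconnected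
      (f := fun ζ => h (Complex.exp ζ) - (F ζ).re)
      (fun ζ hζ => (hder ζ hζ).differentiableAt.differentiableWithinAt)
      (fun ζ hζ => (hder ζ hζ).fderiv)
    exact ⟨a, ha⟩
  obtain ⟨κ, hκ⟩ := hre
  have hshift : ∀ ζ ∈ P, ζ + 2 * π * Complex.I ∈ P := fun ζ hζ => by
    simp only [hP, mem_ofPred_eq] at hζ ⊢
    simpa using hζ
  have hper : ∃ b : ℂ, ∀ ζ ∈ P, F (ζ + 2 * π * Complex.I) - F ζ = b := by
    have hder : ∀ ζ ∈ P, HasDerivAt (fun ζ => F (ζ + 2 * π * Complex.I) - F ζ) 0 ζ := by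
      intro ζ hζ
      have := ((hF' _ (hshift ζ hζ)).comp_add_const ζ (2 * π * Complex.I)).sub (hF' ζ hζ)
      rw [Complex.exp_periodic, sub_self] at this
      exact this
    exact hPo.exists_is_const_of_deriv_eq_zero hPc.isPreconnected
      (fun ζ hζ => (hder ζ hζ).differentiableAt.differentiableWithinAt)
      (fun ζ hζ => (hder ζ hζ).deriv)
  obtain ⟨b, hb⟩ := hper
  have hbre : b.re = 0 := by
    have hmem : ((Real.log R - 1 : ℝ) : ℂ) ∈ P := by simp [hP]
    have h1 := hκ _ hmem
    have h2 := hκ _ (hshift _ hmem)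
    rw [Complex.exp_periodic] at h2
    rw [← hb _ hmem, Complex.sub_re]
    linarith
  obtain ⟨a, ha⟩ : ∃ a : ℝ, b.im = a * (2 * π) := ⟨b.im / (2 * π), by field_simp⟩
  have hba : b = (a : ℂ) * (2 * π * Complex.I) := by
    apply Complex.ext
    · simp [hbre]
    · simp [ha]
  classical
  set E₁ : ℂ → ℂ := fun ζ => if ζ ∈ P then Complex.exp (F ζ + κ - a * ζ) else 0 with hE₁
  have hE₁p : Function.Periodic E₁ (2 * π * Complex.I) := by
    intro ζ
    by_cases hζ : ζ ∈ P
    · simp only [hE₁, if_pos hζ, if_pos (hshift ζ hζ)]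
      congr 1
      linear_combination hb ζ hζ + hba
    · have : ζ + 2 * π * Complex.I ∉ P := by
        simp only [hP, mem_ofPred_eq] at hζ ⊢
        simpa using hζ
      simp only [hE₁, if_neg hζ, if_neg this]
  have hE₁d : ∀ ζ ∈ P, DifferentiableAt ℂ E₁ ζ := by
    intro ζ hζ
    have h1 : DifferentiableAt ℂ (fun ζ => Complex.exp (F ζ + κ - a * ζ)) ζ := by
      have := (hF' ζ hζ).differentiableAt
      fun_prop
    refine h1.congr_of_eventuallyEq ?_
    filter_upwards [hPo.mem_nhds hζ] with w hw
    simp only [hE₁, if_pos hw]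
  have hE₁eq : ∀ ζ ξ, Complex.exp ζ = Complex.exp ξ → E₁ ζ = E₁ ξ := by
    intro ζ ξ hζξ
    obtain ⟨n, rfl⟩ := Complex.exp_eq_exp_iff_exists_int.1 hζξ
    exact hE₁p.int_mul n ξ
  have hlogP : ∀ w ∈ ball (0 : ℂ) R \ {0}, Complex.log w ∈ P := fun w hw => by
    simp only [hP, mem_ofPred_eq, Complex.log_re]
    exact Real.log_lt_log (norm_pos_iff.2 hw.2) (mem_ball_zero_iff.1 hw.1)
  refine ⟨a, fun w => E₁ (Complex.log w), fun w hw => ?_, fun w hw => ?_⟩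
  · refine DifferentiableAt.differentiableWithinAt ?_
    have hw0 : w ≠ 0 := hw.2
    by_cases hs : w ∈ Complex.slitPlane
    · exact (hE₁d _ (hlogP w hw)).comp w (Complex.differentiableAt_log hs)
    · have hs' : -w ∈ Complex.slitPlane := by
        rw [Complex.mem_slitPlane_iff, not_or, not_lt, not_not] at hs
        rw [Complex.mem_slitPlane_iff, Complex.neg_re]
        left
        rcases hs.1.lt_or_eq with h1 | h1
        · linarith
        · exact absurd (Complex.ext h1 hs.2) hw0
      have h1 : DifferentiableAt ℂ (fun w => E₁ (Complex.log (-w) + π * Complex.I)) w := by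
        refine DifferentiableAt.comp w (hE₁d _ ?_)
          (((Complex.differentiableAt_log hs').comp w differentiableAt_id.neg).add_const _)
        have := hlogP (-w) (by simpa using hw)
        simp only [hP, mem_ofPred_eq] at this ⊢
        simpa using this
      refine h1.congr_of_eventuallyEq ?_
      filter_upwards [isOpen_ne.mem_nhds hw0] with v hv
      refine hE₁eq _ _ ?_
      rw [Complex.exp_add, Complex.exp_log hv, Complex.exp_log (neg_ne_zero.2 hv),
        Complex.exp_pi_mul_I]
      ring
  · have hl := hlogP w hw
    have h1 := hκ _ hl
    rw [Complex.exp_log hw.2] at h1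
    simp only [hE₁, if_pos hl, Complex.norm_exp]
    congr 1
    simp [Complex.log_re]
    linarith

/-- Bôcher's theorem for harmonic functions with a one-sided logarithmic bound. -/
lemma exists_eq_log_add_of_harmonicOnNhd (hR : 0 < R)
    (hh : InnerProductSpace.HarmonicOnNhd h (ball 0 R \ {0})) {p C : ℝ}
    (hbd : ∀ w ∈ ball (0 : ℂ) R \ {0}, h w ≤ C - p * Real.log ‖w‖) :
    ∃ α : ℝ, ∃ g : ℂ → ℝ, ContDiffAt ℝ 1 g 0 ∧
      ∀ᶠ w in nhdsWithin (0 : ℂ) {0}ᶜ, h w = α * Real.log ‖w‖ + g w := by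
  obtain ⟨a, E, hE, hEn⟩ := exists_norm_eq_exp_sub_log hR hh
  obtain ⟨N, hN⟩ := exists_nat_ge (p + a)
  set r := min R 1
  have hr : 0 < r := lt_min hR one_pos
  have hsub : ball (0 : ℂ) r \ {0} ⊆ ball 0 R \ {0} :=
    sdiff_subset_sdiff_left (ball_subset_ball (min_le_left _ _))
  set Q : ℂ → ℂ := fun w => w ^ N * E w
  have hQd : DifferentiableOn ℂ Q (ball 0 r \ {0}) :=
    (differentiableOn_id.pow N).mul (hE.mono hsub)
  have hQn : ∀ w ∈ ball (0 : ℂ) R \ {0},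
      ‖Q w‖ = Real.exp (N * Real.log ‖w‖ + h w - a * Real.log ‖w‖) := fun w hw => by
    have hw0 : 0 < ‖w‖ := norm_pos_iff.2 hw.2
    rw [norm_mul, norm_pow, hEn w hw, add_sub_assoc, Real.exp_add, Real.exp_nat_mul,
      Real.exp_log hw0]
  have hQb : BddAbove (norm ∘ Q '' (ball 0 r \ {0})) := by
    refine ⟨Real.exp C, ?_⟩
    rintro _ ⟨w, hw, rfl⟩
    simp only [Function.comp_apply]
    rw [hQn w (hsub hw)]
    refine Real.exp_le_exp.2 ?_
    have h1 := hbd w (hsub hw)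
    have h2 : Real.log ‖w‖ ≤ 0 := Real.log_nonpos (norm_nonneg _)
      ((mem_ball_zero_iff.1 hw.1).le.trans (min_le_right _ _))
    nlinarith [mul_nonpos_of_nonneg_of_nonpos (sub_nonneg.2 hN) h2]
  have hQa := (Complex.differentiableOn_update_limUnder_of_bddAbove (ball_mem_nhds 0 hr) hQd
    hQb).analyticAt (ball_mem_nhds 0 hr)
  set Q' := Function.update Q 0 (Filter.limUnder (nhdsWithin (0 : ℂ) {0}ᶜ) Q)
  have hnear : ∀ᶠ w in nhdsWithin (0 : ℂ) {0}ᶜ, w ∈ ball (0 : ℂ) r \ {0} := by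
    filter_upwards [self_mem_nhdsWithin, nhdsWithin_le_nhds (ball_mem_nhds 0 hr)] with w h1 h2
    exact ⟨h2, h1⟩
  have hQ' : ∀ w, w ≠ 0 → Q' w = Q w := fun w hw => Function.update_of_ne hw _ _
  have hne : ¬∀ᶠ w in nhds (0 : ℂ), Q' w = 0 := by
    intro hz
    obtain ⟨w, h1, h2⟩ := (hnear.and (nhdsWithin_le_nhds hz)).exists
    rw [hQ' w h1.2] at h2
    have h3 := hQn w (hsub h1)
    rw [h2, norm_zero] at h3
    exact (Real.exp_pos _).ne h3
  obtain ⟨m, g, hg, hg0, hgeq⟩ := hQa.exists_eventuallyEq_pow_smul_nonzero_iff.2 hne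
  refine ⟨m - N + a, fun w => Real.log ‖g w‖, ?_, ?_⟩
  · have h1 : ContDiffAt ℝ 1 g 0 := (hg.contDiffAt (n := 1)).restrict_scalars ℝ
    exact (h1.norm ℝ hg0).log (norm_ne_zero_iff.2 hg0)
  · filter_upwards [hnear, nhdsWithin_le_nhds hgeq,
      nhdsWithin_le_nhds (hg.continuousAt.eventually_ne hg0)] with w h1 h2 h3
    have hw0 : ‖w‖ ≠ 0 := norm_ne_zero_iff.2 h1.2
    have h4 := congrArg (fun v => Real.log ‖v‖) (h2.symm.trans (hQ' w h1.2))
    simp only [sub_zero, norm_smul, norm_pow] at h4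
    rw [hQn w (hsub h1), Real.log_exp, Real.log_mul (pow_ne_zero _ hw0) (norm_ne_zero_iff.2 h3),
      Real.log_pow] at h4
    linear_combination -h4

end Bocher

/-- The exponential of a function with the mean value property is sub-mean-valued on discs. -/
lemma exp_mul_le_setIntegral_exp {H : ℂ → ℝ} {z : ℂ} {r R : ℝ} (hc : ContinuousOn H (ball z R))
    (hmv : ∀ s, 0 < s → s < R → circleAverage H z s = H z) (hr : 0 < r) (hrR : r < R) :
    π * r ^ 2 * Real.exp (H z) ≤ ∫ w in ball z r, Real.exp (H w) := by
  have hce : ContinuousOn (fun w => Real.exp (H w)) (ball z R) :=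
    Real.continuous_exp.comp_continuousOn hc
  have hint : IntegrableOn (fun w => Real.exp (H w)) (ball z r) :=
    ((hce.mono (closedBall_subset_ball hrR)).integrableOn_compact
      (isCompact_closedBall z r)).mono_set ball_subset_closedBall
  rw [setIntegral_ball_eq_integral_circleMap (measurable_indicator_of_continuousOn
    measurableSet_ball (hce.mono (ball_subset_ball hrR.le))) hint hr.le]
  have hcirc : ∀ s ∈ Icc 0 r, s * (2 * π * Real.exp (H z)) ≤
      s * ∫ θ in 0..2 * π, Real.exp (H (circleMap z s θ)) := by
    intro s hs
    rcases hs.1.eq_or_lt with rfl | hs0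
    · simp
    refine mul_le_mul_of_nonneg_left ?_ hs.1
    have hm : ∀ θ, circleMap z s θ ∈ ball z R := fun θ =>
      circleMap_mem_ball_of_lt hs.1 (hs.2.trans_lt hrR) θ
    have hcs : Continuous fun θ => H (circleMap z s θ) :=
      hc.comp_continuous (continuous_circleMap z s) hm
    have h1 := hmv s hs0 (hs.2.trans_lt hrR)
    rw [circleAverage_def, smul_eq_mul, inv_mul_eq_iff_eq_mul₀ two_pi_pos.ne'] at h1
    have h2 : ∫ θ in 0..2 * π, Real.exp (H z) * (1 + (H (circleMap z s θ) - H z)) =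
        2 * π * Real.exp (H z) := by
      have h3 : ∀ θ, 1 + (H (circleMap z s θ) - H z) = H (circleMap z s θ) + (1 - H z) :=
        fun θ => by ring
      simp only [h3]
      rw [intervalIntegral.integral_const_mul, intervalIntegral.integral_add
        (hcs.intervalIntegrable _ _) intervalIntegrable_const, h1]
      simp
      ring
    rw [← h2]
    refine intervalIntegral.integral_mono_on two_pi_pos.le
      ((continuous_const.mul (continuous_const.add (hcs.sub continuous_const))).intervalIntegrable
        _ _) ((Real.continuous_exp.comp hcs).intervalIntegrable _ _) fun θ _ => ?_
    calc _ ≤ Real.exp (H z) * Real.exp (H (circleMap z s θ) - H z) := by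
          gcongr
          linarith [Real.add_one_le_exp (H (circleMap z s θ) - H z)]
      _ = _ := by rw [← Real.exp_add]; ring_nf
  have h3 : ∫ s in 0..r, s * (2 * π * Real.exp (H z)) = π * r ^ 2 * Real.exp (H z) := by
    rw [intervalIntegral.integral_mul_const, integral_id]; ring
  rw [← h3]
  refine intervalIntegral.integral_mono_on hr.le
    (Continuous.intervalIntegrable (by fun_prop) _ _) ?_ hcirc
  refine ContinuousOn.intervalIntegrable ?_
  rw [uIcc_of_le hr.le]
  exact continuousOn_id.mul ((continuousOn_integral_circleMap hce).mono
    fun s hs => ⟨by linarith [hs.1], by linarith [hs.2]⟩)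

lemma le_sub_two_mul_log {H u : ℂ → ℝ} {R : ℝ} (hc : ContinuousOn H (ball 0 R \ {0}))
    (hmv : ∀ z r, 0 < r → closedBall z r ⊆ ball 0 R \ {0} → circleAverage H z r = H z)
    (hHu : ∀ w ∈ ball (0 : ℂ) R \ {0}, H w ≤ u w)
    (hu : IntegrableOn (fun w => Real.exp (u w)) (ball 0 R \ {0})) :
    ∃ C, ∀ z ∈ ball (0 : ℂ) (R / 2) \ {0}, H z ≤ C - 2 * Real.log ‖z‖ := by
  set I := ∫ w in ball (0 : ℂ) R \ {0}, Real.exp (u w)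
  refine ⟨Real.log (4 * I / π), fun z hz => ?_⟩
  have hz0 : 0 < ‖z‖ := norm_pos_iff.2 hz.2
  have hzR : ‖z‖ < R / 2 := mem_ball_zero_iff.1 hz.1
  have hsub : ball z ‖z‖ ⊆ ball 0 R \ {0} := by
    intro w hw
    rw [mem_ball, dist_eq_norm] at hw
    refine ⟨?_, ?_⟩
    · rw [mem_ball_zero_iff]
      linarith [norm_sub_norm_le w z]
    · rintro rfl
      simp at hw
  have hcz := hc.mono hsub
  have h1 := exp_mul_le_setIntegral_exp (r := ‖z‖ / 2) hcz (fun s hs hs' =>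
    hmv z s hs ((closedBall_subset_ball hs').trans hsub)) (half_pos hz0) (half_lt_self hz0)
  have hsub2 : ball z (‖z‖ / 2) ⊆ ball 0 R \ {0} := (ball_subset_ball (by linarith)).trans hsub
  have h2 : ∫ w in ball z (‖z‖ / 2), Real.exp (H w) ≤ I := by
    refine (setIntegral_mono_on (((Real.continuous_exp.comp_continuousOn
      (hcz.mono (closedBall_subset_ball (half_lt_self hz0)))).integrableOn_compact
      (isCompact_closedBall z _)).mono_set ball_subset_closedBall) (hu.mono_set hsub2)
      measurableSet_ball fun w hw => Real.exp_le_exp.2 (hHu w (hsub2 hw))).trans ?_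
    exact setIntegral_mono_set hu (ae_of_all _ fun w => (Real.exp_pos _).le) hsub2.eventuallyLE
  have h3 : Real.exp (H z) ≤ 4 * I / π / ‖z‖ ^ 2 := by
    rw [div_div, le_div_iff₀ (by positivity)]
    linarith [h1.trans h2]
  have hI : 0 < 4 * I / π := by
    have := (Real.exp_pos _).trans_le h3
    rwa [lt_div_iff₀ (by positivity), zero_mul] at this
  have h4 := Real.log_le_log (Real.exp_pos _) h3
  rw [Real.log_exp, Real.log_div hI.ne' (by positivity), Real.log_pow] at h4
  exact_mod_cast h4

lemma neg_two_lt_of_integrableOn_exp {u : ℂ → ℝ} {α c ε : ℝ} (hε : 0 < ε)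
    (hu : IntegrableOn (fun w => Real.exp (u w)) (ball 0 ε \ {0}))
    (hle : ∀ w ∈ ball (0 : ℂ) ε \ {0}, α * Real.log ‖w‖ + c ≤ u w) : -2 < α := by
  have h1 : IntegrableOn (fun w : ℂ => ‖w‖ ^ α) (ball 0 ε \ {0}) := by
    refine (hu.const_mul (Real.exp (-c))).mono'
      (Measurable.aestronglyMeasurable (by fun_prop)) ?_
    filter_upwards [ae_restrict_mem (measurableSet_ball.diff (measurableSet_singleton _))]
      with w hw
    rw [Real.norm_of_nonneg (by positivity), rpow_def_of_pos (norm_pos_iff.2 hw.2),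
      ← Real.exp_add]
    exact Real.exp_le_exp.2 (by linarith [hle w hw])
  have h2 : IntegrableOn (fun w : ℂ => ‖w‖ ^ α) (ball 0 ε) :=
    h1.congr_set_ae (sdiff_null_ae_eq_self (measure_singleton 0)).symm
  rw [integrableOn_fun_norm_addHaar volume (f := fun t : ℝ => t ^ α)] at h2
  have h3 : IntegrableOn (fun t : ℝ => t ^ (1 + α)) (Ioo 0 ε) := by
    refine h2.congr_fun (fun t ht => ?_) measurableSet_Ioo
    have ht : 0 < t := ht.1
    simp [rpow_add ht]
  have := (intervalIntegral.integrableOn_Ioo_rpow_iff hε).1 h3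
  linarith

/-- A Jensen-type inequality for densities of total mass at most one. -/
theorem exp_integral_mul_le {X : Type*} [MeasurableSpace X] {μ : Measure X} {φ g : X → ℝ}
    (hg : Integrable g μ) (hg0 : ∀ x, 0 ≤ g x) (hg1 : ∫ x, g x ∂μ ≤ 1)
    (hφ : Integrable (fun x => φ x * g x) μ)
    (he : Integrable (fun x => Real.exp (φ x) * g x) μ) :
    Real.exp (∫ x, φ x * g x ∂μ) ≤ Real.exp 1 + ∫ x, Real.exp (φ x) * g x ∂μ := by
  have hpos : 0 ≤ ∫ x, Real.exp (φ x) * g x ∂μ :=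
    integral_nonneg fun x => mul_nonneg (Real.exp_pos _).le (hg0 x)
  set a := ∫ x, φ x * g x ∂μ with ha
  rcases le_total a 1 with h | h
  · linarith [Real.exp_le_exp.2 h]
  have key : ∫ x, (Real.exp a * (1 - a) * g x + Real.exp a * (φ x * g x)) ∂μ
      ≤ ∫ x, Real.exp (φ x) * g x ∂μ := by
    refine integral_mono ((hg.const_mul _).add (hφ.const_mul _)) he fun x => ?_
    have h1 := Real.add_one_le_exp (φ x - a)
    have h2 : Real.exp (φ x) = Real.exp a * Real.exp (φ x - a) := by
      rw [← Real.exp_add]; ring_nf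
    have h3 : Real.exp a * (φ x - a + 1) * g x ≤ Real.exp (φ x) * g x := by
      rw [h2]; gcongr; exact hg0 x
    simp only
    nlinarith [h3]
  rw [integral_add (hg.const_mul _) (hφ.const_mul _), integral_const_mul, integral_const_mul,
    ← ha] at key
  have h4 : (1 - a) ≤ (1 - a) * ∫ x, g x ∂μ := by nlinarith
  have h5 := mul_le_mul_of_nonneg_left h4 (Real.exp_pos a).le
  nlinarith [Real.exp_pos 1]

theorem rpow_neg_mul_rpow_neg_mul_rpow_neg_le {p q s a b c : ℝ} (hp : 0 ≤ p) (hq : 0 ≤ q)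
    (hs : 0 ≤ s) (ha : 0 < a) (hb : 0 < b) (hc : 0 < c) :
    p ^ (-a) * q ^ (-b) * s ^ (-c)
      ≤ p ^ (-(a + b + c)) + q ^ (-(a + b + c)) + s ^ (-(a + b + c)) := by
  have hn : ∀ t : ℝ, 0 ≤ t → 0 ≤ t ^ (-(a + b + c)) := fun t ht => Real.rpow_nonneg ht _
  rcases hp.eq_or_lt with rfl | hp'
  · rw [Real.zero_rpow (by linarith), zero_mul, zero_mul]
    linarith [hn _ hp, hn _ hq, hn _ hs]
  rcases hq.eq_or_lt with rfl | hq'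
  · rw [Real.zero_rpow (by linarith : -b ≠ 0), mul_zero, zero_mul]
    linarith [hn _ hp, hn _ hq, hn _ hs]
  rcases hs.eq_or_lt with rfl | hs'
  · rw [Real.zero_rpow (by linarith : -c ≠ 0), mul_zero]
    linarith [hn _ hp, hn _ hq, hn _ hs]
  have key : ∀ d : ℝ, 0 < d → d ≤ p → d ≤ q → d ≤ s →
      p ^ (-a) * q ^ (-b) * s ^ (-c) ≤ d ^ (-(a + b + c)) := by
    intro d hd h1 h2 h3
    have e : d ^ (-(a + b + c)) = d ^ (-a) * d ^ (-b) * d ^ (-c) := by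
      rw [← Real.rpow_add hd, ← Real.rpow_add hd]; ring_nf
    rw [e]
    have i1 := Real.rpow_le_rpow_of_nonpos hd h1 (by linarith : -a ≤ 0)
    have i2 := Real.rpow_le_rpow_of_nonpos hd h2 (by linarith : -b ≤ 0)
    have i3 := Real.rpow_le_rpow_of_nonpos hd h3 (by linarith : -c ≤ 0)
    gcongr
  have n1 := hn _ hp
  have n2 := hn _ hq
  have n3 := hn _ hs
  rcases le_total p q with h1 | h1 <;> rcases le_total q s with h2 | h2 <;>
    rcases le_total p s with h3 | h3
  · linarith [key p hp' le_rfl h1 h3]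
  · linarith [key p hp' le_rfl h1 (h1.trans h2)]
  · linarith [key p hp' le_rfl h1 h3]
  · linarith [key s hs' h3 h2 le_rfl]
  · linarith [key q hq' h1 le_rfl h2]
  · linarith [key q hq' h1 le_rfl h2]
  · linarith [key s hs' (h2.trans h1) h2 le_rfl]
  · linarith [key s hs' h3 h2 le_rfl]

/-- The integral of `‖y - w‖ ^ (-σ)` over the unit ball is bounded uniformly in `w`. -/
theorem lintegral_rpow_neg_norm_sub_le {σ : ℝ} (hσ0 : 0 ≤ σ) (w : ℂ) :
    ∫⁻ y in ball (0 : ℂ) 1, ENNReal.ofReal (‖y - w‖ ^ (-σ))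
      ≤ (∫⁻ y in ball (0 : ℂ) 1, ENNReal.ofReal (‖y‖ ^ (-σ))) + volume (ball (0 : ℂ) 1) := by
  have hpt : ∀ y, ENNReal.ofReal (‖y - w‖ ^ (-σ))
      ≤ (ball (0 : ℂ) 1).indicator (fun y => ENNReal.ofReal (‖y‖ ^ (-σ))) (y - w) + 1 := by
    intro y
    by_cases hy : y - w ∈ ball (0 : ℂ) 1
    · rw [indicator_of_mem hy]; exact le_self_add
    · rw [indicator_of_notMem hy, zero_add]
      refine ENNReal.ofReal_le_one.2 (Real.rpow_le_one_of_one_le_of_nonpos ?_ (by linarith))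
      simpa using hy
  calc ∫⁻ y in ball (0 : ℂ) 1, ENNReal.ofReal (‖y - w‖ ^ (-σ))
      ≤ ∫⁻ y in ball (0 : ℂ) 1,
          ((ball (0 : ℂ) 1).indicator (fun y => ENNReal.ofReal (‖y‖ ^ (-σ))) (y - w) + 1) :=
        lintegral_mono hpt
    _ = (∫⁻ y in ball (0 : ℂ) 1,
          (ball (0 : ℂ) 1).indicator (fun y => ENNReal.ofReal (‖y‖ ^ (-σ))) (y - w))
          + volume (ball (0 : ℂ) 1) := by
        rw [lintegral_add_right _ measurable_const]; simp
    _ ≤ (∫⁻ y, (ball (0 : ℂ) 1).indicator (fun y => ENNReal.ofReal (‖y‖ ^ (-σ))) (y - w))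
          + volume (ball (0 : ℂ) 1) := by
        gcongr; exact Measure.restrict_le_self
    _ = _ := by
        rw [lintegral_sub_right_eq_self
          (fun y => (ball (0 : ℂ) 1).indicator (fun y => ENNReal.ofReal (‖y‖ ^ (-σ))) y) w,
          lintegral_indicator measurableSet_ball]

/-- Uniform bound for the triple product of singular kernels. -/
theorem exists_lintegral_rpow_neg_mul_le {a b c : ℝ} (ha : 0 < a) (hb : 0 < b) (hc : 0 < c)
    (habc : a + b + c < 2) : ∃ J : ℝ≥0∞, J ≠ ∞ ∧ ∀ x w : ℂ,
      ∫⁻ y in ball (0 : ℂ) 1,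
        ENNReal.ofReal (‖x - y‖ ^ (-a) * ‖y‖ ^ (-b) * ‖y - w‖ ^ (-c)) ≤ J := by
  set σ := a + b + c with hσ
  set J₀ := (∫⁻ y in ball (0 : ℂ) 1, ENNReal.ofReal (‖y‖ ^ (-σ))) + volume (ball (0 : ℂ) 1)
    with hJ₀
  have hfin : J₀ ≠ ∞ := by
    refine ENNReal.add_ne_top.2 ⟨?_, measure_ball_lt_top.ne⟩
    have := (integrableOn_norm_rpow_neg_ball habc 1).lintegral_lt_top
    exact this.ne
  have hm : ∀ w : ℂ, Measurable fun y : ℂ => ENNReal.ofReal (‖y - w‖ ^ (-σ)) := fun w => by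
    fun_prop
  refine ⟨J₀ + J₀ + J₀, by simp [hfin], fun x w => ?_⟩
  calc ∫⁻ y in ball (0 : ℂ) 1,
        ENNReal.ofReal (‖x - y‖ ^ (-a) * ‖y‖ ^ (-b) * ‖y - w‖ ^ (-c))
      ≤ ∫⁻ y in ball (0 : ℂ) 1, (ENNReal.ofReal (‖y - x‖ ^ (-σ))
          + ENNReal.ofReal (‖y - 0‖ ^ (-σ)) + ENNReal.ofReal (‖y - w‖ ^ (-σ))) := by
        refine lintegral_mono fun y => ?_
        rw [← ENNReal.ofReal_add (by positivity) (by positivity),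
          ← ENNReal.ofReal_add (by positivity) (by positivity), norm_sub_rev y x, sub_zero]
        exact ENNReal.ofReal_le_ofReal (rpow_neg_mul_rpow_neg_mul_rpow_neg_le
          (norm_nonneg _) (norm_nonneg _) (norm_nonneg _) ha hb hc)
    _ ≤ J₀ + J₀ + J₀ := by
        rw [lintegral_add_right _ (hm w), lintegral_add_right _ (hm 0)]
        have h := fun w => lintegral_rpow_neg_norm_sub_le (σ := σ) (by positivity) w
        exact add_le_add (add_le_add (h x) (h 0)) (h w)

/-- A density dominated near the origin by a singular weight times its own Riesz-type potential
has uniformly bounded potentials of small order. -/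
theorem exists_bound_rpow_neg_mul_of_le {f : ℂ → ℝ} (hf : Measurable f) (hfi : Integrable f)
    (hf0 : ∀ y, 0 ≤ f y) {r A a ε γ : ℝ} (hr : 0 < r) (hr1 : r ≤ 1) (hA : 0 ≤ A)
    (ha : 0 < a) (hε : 0 < ε) (hγ : 0 < γ) (hlt : γ + a + ε < 2)
    (hle : ∀ y ∈ ball (0 : ℂ) r, f y ≤ A * ‖y‖ ^ (-a) * (1 + ∫ w, ‖y - w‖ ^ (-ε) * f w)) :
    ∃ S, ∀ x ∈ ball (0 : ℂ) (r / 2), Integrable (fun y => ‖x - y‖ ^ (-γ) * f y) ∧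
      ∫ y, ‖x - y‖ ^ (-γ) * f y ≤ S := by
  obtain ⟨J, hJ, hJle⟩ := exists_lintegral_rpow_neg_mul_le hγ ha hε hlt
  set F := ∫⁻ y, ENNReal.ofReal (f y) with hF
  have hFfin : F ≠ ∞ := hfi.lintegral_lt_top.ne
  set T := ENNReal.ofReal A * (J + J * F) + ENNReal.ofReal ((r / 2) ^ (-γ)) * F with hT
  have hTfin : T ≠ ∞ := by
    simp only [hT]; finiteness
  have main : ∀ x ∈ ball (0 : ℂ) (r / 2),
      ∫⁻ y, ENNReal.ofReal (‖x - y‖ ^ (-γ) * f y) ≤ T := by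
    intro x hx
    rw [← lintegral_add_compl _ (measurableSet_ball (x := (0 : ℂ)) (ε := r))]
    refine add_le_add ?_ ?_
    · have hpt : ∀ y ∈ ball (0 : ℂ) r, ENNReal.ofReal (‖x - y‖ ^ (-γ) * f y)
          ≤ ENNReal.ofReal A * (ENNReal.ofReal (‖x - y‖ ^ (-γ) * ‖y‖ ^ (-a) * ‖y - 0‖ ^ (-ε))
            + ∫⁻ w, ENNReal.ofReal (‖x - y‖ ^ (-γ) * ‖y‖ ^ (-a) * ‖y - w‖ ^ (-ε))
              * ENNReal.ofReal (f w)) := by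
        intro y hy
        have h0 : 0 ≤ ∫ w, ‖y - w‖ ^ (-ε) * f w :=
          integral_nonneg fun w => mul_nonneg (by positivity) (hf0 w)
        have h1 : ENNReal.ofReal (∫ w, ‖y - w‖ ^ (-ε) * f w)
            ≤ ∫⁻ w, ENNReal.ofReal (‖y - w‖ ^ (-ε) * f w) := by
          by_cases hi : Integrable fun w => ‖y - w‖ ^ (-ε) * f w
          · rw [ofReal_integral_eq_lintegral_ofReal hi
              (Filter.Eventually.of_forall fun w => mul_nonneg (by positivity) (hf0 w))]
          · rw [integral_undef hi]; simp
        have h2 : ‖x - y‖ ^ (-γ) * f y ≤ A * (‖x - y‖ ^ (-γ) * ‖y‖ ^ (-a)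
            + ‖x - y‖ ^ (-γ) * ‖y‖ ^ (-a) * ∫ w, ‖y - w‖ ^ (-ε) * f w) := by
          calc ‖x - y‖ ^ (-γ) * f y ≤ ‖x - y‖ ^ (-γ)
                * (A * ‖y‖ ^ (-a) * (1 + ∫ w, ‖y - w‖ ^ (-ε) * f w)) := by
                gcongr; exact hle y hy
            _ = _ := by ring
        refine (ENNReal.ofReal_le_ofReal h2).trans ?_
        rw [ENNReal.ofReal_mul hA, ENNReal.ofReal_add (by positivity)
          (mul_nonneg (by positivity) h0)]
        gcongr _ * (?_ + ?_)
        · refine ENNReal.ofReal_le_ofReal ?_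
          rcases eq_or_ne y 0 with rfl | hy0
          · rw [norm_zero, Real.zero_rpow (by linarith)]; simp
          · refine le_mul_of_one_le_right (by positivity) ?_
            have := mem_ball_zero_iff.1 hy
            rw [sub_zero]
            exact Real.one_le_rpow_of_pos_of_le_one_of_nonpos (by simpa using hy0)
              (by linarith) (by linarith)
        · rw [ENNReal.ofReal_mul (by positivity)]
          calc _ ≤ ENNReal.ofReal (‖x - y‖ ^ (-γ) * ‖y‖ ^ (-a))
                * ∫⁻ w, ENNReal.ofReal (‖y - w‖ ^ (-ε) * f w) := by gcongr
            _ = _ := by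
                rw [← lintegral_const_mul' _ _ ENNReal.ofReal_ne_top]
                refine lintegral_congr fun w => ?_
                rw [← ENNReal.ofReal_mul (by positivity), ← ENNReal.ofReal_mul (by positivity),
                  mul_assoc _ _ (f w)]
      have hm1 : Measurable fun y : ℂ =>
          ENNReal.ofReal (‖x - y‖ ^ (-γ) * ‖y‖ ^ (-a) * ‖y - 0‖ ^ (-ε)) := by fun_prop
      have hm2 : Measurable fun p : ℂ × ℂ =>
          ENNReal.ofReal (‖x - p.1‖ ^ (-γ) * ‖p.1‖ ^ (-a) * ‖p.1 - p.2‖ ^ (-ε))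
            * ENNReal.ofReal (f p.2) := by fun_prop
      calc ∫⁻ y in ball (0 : ℂ) r, ENNReal.ofReal (‖x - y‖ ^ (-γ) * f y)
          ≤ ∫⁻ y in ball (0 : ℂ) r, ENNReal.ofReal A *
            (ENNReal.ofReal (‖x - y‖ ^ (-γ) * ‖y‖ ^ (-a) * ‖y - 0‖ ^ (-ε))
            + ∫⁻ w, ENNReal.ofReal (‖x - y‖ ^ (-γ) * ‖y‖ ^ (-a) * ‖y - w‖ ^ (-ε))
              * ENNReal.ofReal (f w)) := setLIntegral_mono' measurableSet_ball hpt
        _ ≤ ∫⁻ y in ball (0 : ℂ) 1, ENNReal.ofReal A *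
            (ENNReal.ofReal (‖x - y‖ ^ (-γ) * ‖y‖ ^ (-a) * ‖y - 0‖ ^ (-ε))
            + ∫⁻ w, ENNReal.ofReal (‖x - y‖ ^ (-γ) * ‖y‖ ^ (-a) * ‖y - w‖ ^ (-ε))
              * ENNReal.ofReal (f w)) := lintegral_mono_set (ball_subset_ball hr1)
        _ = ENNReal.ofReal A *
            ((∫⁻ y in ball (0 : ℂ) 1,
              ENNReal.ofReal (‖x - y‖ ^ (-γ) * ‖y‖ ^ (-a) * ‖y - 0‖ ^ (-ε)))
            + ∫⁻ w, (∫⁻ y in ball (0 : ℂ) 1,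
              ENNReal.ofReal (‖x - y‖ ^ (-γ) * ‖y‖ ^ (-a) * ‖y - w‖ ^ (-ε)))
              * ENNReal.ofReal (f w)) := by
            rw [lintegral_const_mul' _ _ ENNReal.ofReal_ne_top, lintegral_add_left hm1,
              lintegral_lintegral_swap hm2.aemeasurable]
            congr 2
            refine lintegral_congr fun w => ?_
            rw [lintegral_mul_const' _ _ ENNReal.ofReal_ne_top]
        _ ≤ ENNReal.ofReal A * (J + ∫⁻ w, J * ENNReal.ofReal (f w)) := by
            gcongr
            · exact hJle x 0
            · exact hJle x _
        _ = ENNReal.ofReal A * (J + J * F) := by rw [lintegral_const_mul' _ _ hJ]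
    · calc ∫⁻ y in (ball (0 : ℂ) r)ᶜ, ENNReal.ofReal (‖x - y‖ ^ (-γ) * f y)
          ≤ ∫⁻ y in (ball (0 : ℂ) r)ᶜ, ENNReal.ofReal ((r / 2) ^ (-γ)) * ENNReal.ofReal (f y) := by
            refine setLIntegral_mono' measurableSet_ball.compl fun y hy => ?_
            rw [ENNReal.ofReal_mul (by positivity)]
            gcongr ENNReal.ofReal ?_ * _
            refine Real.rpow_le_rpow_of_nonpos (by linarith) ?_ (by linarith)
            have h1 : r ≤ ‖y‖ := by simpa using hy
            have h2 : ‖x‖ < r / 2 := by simpa using hx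
            have h3 := norm_sub_norm_le y x
            rw [norm_sub_rev] at h3
            linarith
        _ ≤ ∫⁻ y, ENNReal.ofReal ((r / 2) ^ (-γ)) * ENNReal.ofReal (f y) := by
            gcongr; exact Measure.restrict_le_self
        _ = ENNReal.ofReal ((r / 2) ^ (-γ)) * F := by
            rw [lintegral_const_mul' _ _ ENNReal.ofReal_ne_top]
  refine ⟨T.toReal, fun x hx => ?_⟩
  have hn : ∀ y, 0 ≤ ‖x - y‖ ^ (-γ) * f y := fun y => mul_nonneg (by positivity) (hf0 y)
  have hmx : Measurable fun y => ‖x - y‖ ^ (-γ) * f y := by fun_prop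
  refine ⟨⟨hmx.aestronglyMeasurable, ?_⟩, ?_⟩
  · rw [hasFiniteIntegral_iff_ofReal (Filter.Eventually.of_forall hn)]
    exact (main x hx).trans_lt hTfin.lt_top
  · rw [integral_eq_lintegral_of_nonneg_ae (Filter.Eventually.of_forall hn)
      hmx.aestronglyMeasurable]
    exact ENNReal.toReal_mono hTfin (main x hx)

section ExpLogPotential
variable {f : ℂ → ℝ} {R c : ℝ}

lemma exists_pos_setIntegral_ball_le (hfi : Integrable f) {δ : ℝ} (hδ : 0 < δ) :
    ∃ r > 0, ∫ y in ball (0 : ℂ) r, f y ≤ δ := by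
  have h1 : Filter.Tendsto (volume ∘ fun r : ℝ => ball (0 : ℂ) r)
      (nhdsWithin 0 (Ioi 0)) (nhds 0) := by
    have h : Filter.Tendsto (fun r : ℝ => ENNReal.ofReal r ^ 2 * (NNReal.pi : ℝ≥0∞))
        (nhdsWithin 0 (Ioi 0)) (nhds (ENNReal.ofReal 0 ^ 2 * (NNReal.pi : ℝ≥0∞))) := by
      refine Filter.Tendsto.mono_left (ENNReal.Tendsto.mul_const ?_ (Or.inr ENNReal.coe_ne_top))
        nhdsWithin_le_nhds
      exact ENNReal.Tendsto.pow (ENNReal.tendsto_ofReal Filter.tendsto_id)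
    simpa [Function.comp_def, Complex.volume_ball] using h
  obtain ⟨r, hr1, hr2⟩ := ((hfi.tendsto_setIntegral_nhds_zero h1).eventually_le_const hδ |>.and
    self_mem_nhdsWithin).exists
  exact ⟨r, hr2, hr1⟩

/-- Near the origin, the exponential of the logarithmic potential is controlled by a Riesz-type
potential of arbitrarily small order. -/
lemma exists_exp_logPotential_le (hfi : Integrable f) (hf0 : ∀ y, 0 ≤ f y)
    (hfs : ∀ y, y ∉ ball 0 R → f y = 0) (hloc : ∀ ρ > 0, ∃ C, ∀ y, ρ ≤ ‖y‖ → f y ≤ C)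
    (hR : 0 < R) (hc : 2 * R ≤ c) {ε : ℝ} (hε : 0 < ε) (hε2 : ε < 2) :
    ∃ r > 0, ∃ C, 0 ≤ C ∧ ∀ x ∈ ball (0 : ℂ) r \ {0},
      Real.exp ((2 * π)⁻¹ * logPotential c f x) ≤ C * (1 + ∫ w, ‖x - w‖ ^ (-ε) * f w) := by
  have hc0 : 0 < c := by linarith
  obtain ⟨ρ, hρ, hρle⟩ := exists_pos_setIntegral_ball_le hfi (by positivity : 0 < 2 * π * ε)
  set L := |Real.log (c / (ρ / 2))| with hL
  set K := Real.exp ((2 * π)⁻¹ * (L * ∫ w, f w)) with hK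
  set D := (2 * π * ε)⁻¹ * c ^ ε with hD
  have hD0 : 0 ≤ D := by positivity
  have hF0 : 0 ≤ ∫ w, f w := integral_nonneg hf0
  refine ⟨min R (ρ / 2), by positivity, K * (Real.exp 1 + D), by positivity, fun x hx => ?_⟩
  have hxn : ‖x‖ < min R (ρ / 2) := mem_ball_zero_iff.1 hx.1
  have hxR : x ∈ ball (0 : ℂ) R := mem_ball_zero_iff.2 (hxn.trans_le (min_le_left _ _))
  have hxρ : ‖x‖ < ρ / 2 := hxn.trans_le (min_le_right _ _)
  obtain ⟨S, hS⟩ := exists_bound_rpow_neg_mul hfi hf0 hloc hε.le hε2 (norm_pos_iff.2 hx.2)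
  have hi := (hS x le_rfl).1
  have hlog := integrable_log_div_mul hfi hf0 hfs hR hc hε hxR hi
  set g : ℂ → ℝ := fun w => (2 * π * ε)⁻¹ * (ball (0 : ℂ) ρ).indicator f w with hg
  set φ : ℂ → ℝ := fun w => ε * Real.log (c / ‖x - w‖) with hφ
  have hgi : Integrable g := (hfi.indicator measurableSet_ball).const_mul _
  have hind0 : ∀ w, 0 ≤ (ball (0 : ℂ) ρ).indicator f w :=
    fun w => indicator_nonneg (fun y _ => hf0 y) w
  have hind1 : ∀ w, (ball (0 : ℂ) ρ).indicator f w ≤ f w :=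
    fun w => indicator_le_self' (fun y _ => hf0 y) w
  have hg0 : ∀ w, 0 ≤ g w := fun w => mul_nonneg (by positivity) (hind0 w)
  have hg1 : ∫ w, g w ≤ 1 := by
    simp only [hg]
    rw [integral_const_mul, integral_indicator measurableSet_ball, inv_mul_le_iff₀ (by positivity),
      mul_one]
    exact hρle
  have hφg : Integrable fun w => φ w * g w := by
    refine ((hlog.indicator (measurableSet_ball (x := (0 : ℂ)) (ε := ρ))).const_mul
      (2 * π)⁻¹).congr (Filter.Eventually.of_forall fun w => ?_)
    by_cases hw : w ∈ ball (0 : ℂ) ρ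
    · simp only [hφ, hg, indicator_of_mem hw]; field_simp
    · simp only [hg, indicator_of_notMem hw]; ring
  have hexp : ∀ w, w ≠ x → Real.exp (φ w) * g w
      = D * (‖x - w‖ ^ (-ε) * (ball (0 : ℂ) ρ).indicator f w) := by
    intro w hw
    have hpos : 0 < ‖x - w‖ := norm_pos_iff.2 (sub_ne_zero.2 hw.symm)
    have : Real.exp (φ w) = c ^ ε * ‖x - w‖ ^ (-ε) := by
      simp only [hφ]
      rw [mul_comm, ← Real.rpow_def_of_pos (by positivity), Real.div_rpow hc0.le hpos.le,
        Real.rpow_neg hpos.le, div_eq_mul_inv]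
    rw [this]; simp only [hg, hD]; ring
  have hae : (fun w => D * (‖x - w‖ ^ (-ε) * (ball (0 : ℂ) ρ).indicator f w))
      =ᵐ[volume] fun w => Real.exp (φ w) * g w := by
    have : ∀ᵐ w : ℂ, w ≠ x := by simp [ae_iff]
    filter_upwards [this] with w hw using (hexp w hw).symm
  have hindi : Integrable fun w => ‖x - w‖ ^ (-ε) * (ball (0 : ℂ) ρ).indicator f w := by
    refine (hi.indicator (measurableSet_ball (x := (0 : ℂ)) (ε := ρ))).congr
      (Filter.Eventually.of_forall fun w => ?_)
    by_cases hw : w ∈ ball (0 : ℂ) ρ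
    · simp only [indicator_of_mem hw]
    · simp only [indicator_of_notMem hw, mul_zero]
  have hei : Integrable fun w => Real.exp (φ w) * g w := (hindi.const_mul D).congr hae
  have key := exp_integral_mul_le hgi hg0 hg1 hφg hei
  have hV : (2 * π)⁻¹ * logPotential c f x ≤ (∫ w, φ w * g w) + (2 * π)⁻¹ * (L * ∫ w, f w) := by
    rw [logPotential, ← integral_const_mul, ← integral_const_mul, ← integral_const_mul,
      ← integral_add hφg ((hfi.const_mul _).const_mul _)]
    refine integral_mono (hlog.const_mul _) (hφg.add ((hfi.const_mul _).const_mul _)) fun w => ?_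
    simp only
    by_cases hw : w ∈ ball (0 : ℂ) ρ
    · have : 0 ≤ (2 * π)⁻¹ * (L * f w) :=
        mul_nonneg (by positivity) (mul_nonneg (abs_nonneg _) (hf0 w))
      simp only [hφ, hg, indicator_of_mem hw]
      have e : ε * Real.log (c / ‖x - w‖) * ((2 * π * ε)⁻¹ * f w)
          = (2 * π)⁻¹ * (Real.log (c / ‖x - w‖) * f w) := by field_simp
      rw [e]; linarith
    · simp only [hg, indicator_of_notMem hw, mul_zero, zero_add]
      have h1 : ρ ≤ ‖w‖ := by simpa using hw
      have h3 := norm_sub_norm_le w x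
      rw [norm_sub_rev] at h3
      have h4 : Real.log (c / ‖x - w‖) ≤ L := by
        refine (Real.log_le_log (div_pos hc0 (by linarith)) ?_).trans (le_abs_self _)
        exact div_le_div_of_nonneg_left hc0.le (by positivity) (by linarith)
      have := hf0 w
      gcongr
  have hle : ∫ w, Real.exp (φ w) * g w ≤ D * ∫ w, ‖x - w‖ ^ (-ε) * f w := by
    rw [← integral_congr_ae hae, integral_const_mul]
    refine mul_le_mul_of_nonneg_left (integral_mono hindi hi fun w => ?_) hD0
    exact mul_le_mul_of_nonneg_left (hind1 w) (by positivity)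
  have hI0 : 0 ≤ ∫ w, ‖x - w‖ ^ (-ε) * f w :=
    integral_nonneg fun w => mul_nonneg (by positivity) (hf0 w)
  calc Real.exp ((2 * π)⁻¹ * logPotential c f x)
      ≤ Real.exp ((∫ w, φ w * g w) + (2 * π)⁻¹ * (L * ∫ w, f w)) := Real.exp_le_exp.2 hV
    _ = K * Real.exp (∫ w, φ w * g w) := by rw [Real.exp_add, mul_comm]
    _ ≤ K * (Real.exp 1 + D * ∫ w, ‖x - w‖ ^ (-ε) * f w) := by
        gcongr; linarith
    _ ≤ K * ((Real.exp 1 + D) * (1 + ∫ w, ‖x - w‖ ^ (-ε) * f w)) := by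
        gcongr
        nlinarith [mul_nonneg (Real.exp_pos 1).le hI0]
    _ = _ := by ring

end ExpLogPotential

lemma ContDiffOn.continuousOn_laplacian {U : ℂ → ℝ} {Ω : Set ℂ} (hΩ : IsOpen Ω)
    (hU : ContDiffOn ℝ 2 U Ω) : ContinuousOn (Laplacian.laplacian U) Ω := by
  have h1 : ContDiffOn ℝ 1 (fderiv ℝ U) Ω := hU.fderiv_of_isOpen hΩ (by norm_num)
  have h2 := h1.continuousOn_fderiv_of_isOpen hΩ (by norm_num)
  rw [InnerProductSpace.laplacian_eq_iteratedFDeriv_complexPlane]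
  simp only [iteratedFDeriv_two_apply]
  fun_prop

lemma holderOnWith_of_abs_sub_le {X : Type*} [PseudoMetricSpace X] {φ : X → ℝ} {s : Set X}
    {C γ : ℝ≥0} (h : ∀ x ∈ s, ∀ y ∈ s, |φ x - φ y| ≤ C * dist x y ^ (γ : ℝ)) :
    HolderOnWith C γ φ s := by
  intro x hx y hy
  rw [edist_dist, edist_dist, ENNReal.ofReal_rpow_of_nonneg dist_nonneg γ.coe_nonneg,
    ← ENNReal.ofReal_coe_nnreal, ← ENNReal.ofReal_mul C.coe_nonneg]
  exact ENNReal.ofReal_le_ofReal (h x hx y hy)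

/-- Isolated singularities of `0 ≤ -Δu ≤ M e^u` with `e^u` integrable, on the complex plane. -/
theorem exists_eq_log_add_holder_of_laplacian {u : ℂ → ℝ} {M : ℝ}
    (hu : ContDiffOn ℝ 2 u (ball 0 1 \ {0}))
    (hΔ0 : ∀ w ∈ ball (0 : ℂ) 1 \ {0}, 0 ≤ -Laplacian.laplacian u w)
    (hΔM : ∀ w ∈ ball (0 : ℂ) 1 \ {0}, -Laplacian.laplacian u w ≤ M * Real.exp (u w))
    (hint : IntegrableOn (fun w => Real.exp (u w)) (ball 0 1 \ {0})) :
    ∃ α : ℝ, -2 < α ∧ ∃ γ : ℝ≥0, 0 < γ ∧ γ < 1 ∧ ∃ r > (0 : ℝ), ∃ φ : ℂ → ℝ,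
      (∃ C, HolderOnWith C γ φ (ball 0 r)) ∧
      ∀ w ∈ ball (0 : ℂ) r \ {0}, u w = α * Real.log ‖w‖ + φ w := by
  set R : ℝ := 1 / 2 with hR
  have hR0 : 0 < R := by norm_num [hR]
  have hc : 2 * R ≤ 1 := by norm_num [hR]
  have hsub : ball (0 : ℂ) R \ {0} ⊆ ball 0 1 \ {0} :=
    sdiff_subset_sdiff_left (ball_subset_ball (by norm_num [hR]))
  have hmeasR : MeasurableSet (ball (0 : ℂ) R \ {0}) :=
    measurableSet_ball.diff (measurableSet_singleton _)
  have hopen1 : IsOpen (ball (0 : ℂ) 1 \ {0}) := isOpen_ball.sdiff isClosed_singleton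
  have hopenR : IsOpen (ball (0 : ℂ) R \ {0}) := isOpen_ball.sdiff isClosed_singleton
  have huR := hu.mono hsub
  have hintR := hint.mono_set hsub
  have hlap : ContinuousOn (fun w => -Laplacian.laplacian u w) (ball 0 1 \ {0}) :=
    (hu.continuousOn_laplacian hopen1).neg
  set f : ℂ → ℝ := (ball (0 : ℂ) R \ {0}).indicator fun w => -Laplacian.laplacian u w with hf
  have hfm : Measurable f := measurable_indicator_of_continuousOn hmeasR (hlap.mono hsub)
  have hf0 : ∀ y, 0 ≤ f y := indicator_nonneg fun y hy => hΔ0 y (hsub hy)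
  have hfs : ∀ y, y ∉ ball 0 R → f y = 0 := fun y hy => indicator_of_notMem (fun h => hy h.1) _
  have hfM : ∀ y ∈ ball (0 : ℂ) R \ {0}, f y ≤ |M| * Real.exp (u y) := fun y hy => by
    rw [hf, indicator_of_mem hy]
    exact (hΔM y (hsub hy)).trans (mul_le_mul_of_nonneg_right (le_abs_self M) (exp_pos _).le)
  have hΔ : ∀ w ∈ ball 0 R \ {0}, f w = -Laplacian.laplacian u w := fun w hw =>
    indicator_of_mem hw _
  have hfi : Integrable f := by
    rw [hf, integrable_indicator_iff hmeasR]
    refine (hintR.const_mul |M|).mono' ((hlap.mono hsub).aestronglyMeasurable hmeasR) ?_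
    filter_upwards [ae_restrict_mem hmeasR] with w hw
    rw [Real.norm_of_nonneg (hΔ0 w (hsub hw)), ← hΔ w hw]
    exact hfM w hw
  have hloc : ∀ ρ > 0, ∃ C, ∀ y, ρ ≤ ‖y‖ → f y ≤ C := by
    intro ρ hρ
    have hcpt : IsCompact (closedBall (0 : ℂ) R \ ball 0 ρ) :=
      (isCompact_closedBall _ _).diff isOpen_ball
    have hsub' : closedBall (0 : ℂ) R \ ball 0 ρ ⊆ ball 0 1 \ {0} := by
      refine sdiff_subset_sdiff (closedBall_subset_ball (by norm_num [hR])) ?_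
      simpa using hρ
    obtain ⟨C, hC⟩ := hcpt.exists_bound_of_continuousOn (hlap.mono hsub')
    refine ⟨max C 0, fun y hy => ?_⟩
    by_cases hyR : y ∈ ball (0 : ℂ) R \ {0}
    · rw [hΔ y hyR]
      exact (le_abs_self _).trans ((hC y ⟨ball_subset_closedBall hyR.1, by simpa using hy⟩).trans
        (le_max_left _ _))
    · rw [hf, indicator_of_notMem hyR]; exact le_max_right _ _
  set V := logPotential 1 f with hVdef
  have hV0 : ∀ x ∈ ball (0 : ℂ) R, 0 ≤ V x := fun x hx => logPotential_nonneg hf0 hfs hc hx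
  have hVc := continuousOn_logPotential hfi hf0 hfs hloc hR0 hc
  set H : ℂ → ℝ := fun w => (2 * π)⁻¹ • (2 * π * u w - V w) with hH
  have hπ : 0 < (2 * π)⁻¹ := by positivity
  have hHu : ∀ w, H w = u w - (2 * π)⁻¹ * V w := fun w => by
    simp only [hH, smul_eq_mul]; field_simp
  have hHc : ContinuousOn H (ball 0 R \ {0}) :=
    ContinuousOn.const_smul (g := fun w => 2 * π * u w - V w)
      ((continuousOn_const.mul huR.continuousOn).sub hVc) (2 * π)⁻¹
  have hHmv : ∀ z r, 0 < r → closedBall z r ⊆ ball 0 R \ {0} → circleAverage H z r = H z := by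
    intro z r hr hzr
    have := sub_logPotential_eq_circleAverage huR hΔ hfi hf0 hfs hloc hR0 hc hr hzr
    rw [hH, circleAverage_fun_smul, this]
  obtain ⟨C₀, hC₀⟩ := le_sub_two_mul_log hHc hHmv (fun w hw => by
    rw [hHu]; linarith [mul_nonneg hπ.le (hV0 w hw.1)]) hintR
  have hharm := harmonicOnNhd_of_circleAverage_eq hopenR hHc hHmv
  have hsub2 : ball (0 : ℂ) (R / 2) \ {0} ⊆ ball 0 R \ {0} :=
    sdiff_subset_sdiff_left (ball_subset_ball (by linarith))
  obtain ⟨α, g, hg, hgα⟩ := exists_eq_log_add_of_harmonicOnNhd (half_pos hR0)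
    (fun w hw => hharm w (hsub2 hw)) hC₀
  obtain ⟨Lg, t, ht, hLg⟩ := hg.exists_lipschitzOnWith
  obtain ⟨r₁, hr₁, hr₁t⟩ := Metric.mem_nhds_iff.1 ht
  obtain ⟨r₂, hr₂, hr₂α⟩ := Metric.mem_nhdsWithin_iff.1 hgα
  obtain ⟨r₀, hr₀, h01, h02, h0R⟩ : ∃ r₀ > 0, r₀ ≤ r₁ ∧ r₀ ≤ r₂ ∧ r₀ ≤ R :=
    ⟨min r₁ (min r₂ R), by positivity, min_le_left _ _, (min_le_right _ _).trans (min_le_left _ _),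
      (min_le_right _ _).trans (min_le_right _ _)⟩
  have hgL : ∀ x ∈ ball (0 : ℂ) r₀, ∀ y ∈ ball (0 : ℂ) r₀, |g x - g y| ≤ Lg * dist x y :=
    fun x hx y hy => hLg.dist_le_mul x (hr₁t (ball_subset_ball h01 hx)) y
      (hr₁t (ball_subset_ball h01 hy))
  have hueq : ∀ w ∈ ball (0 : ℂ) r₀ \ {0}, u w = α * Real.log ‖w‖ + ((2 * π)⁻¹ * V w + g w) := by
    intro w hw
    have : H w = α * Real.log ‖w‖ + g w := hr₂α ⟨ball_subset_ball h02 hw.1, hw.2⟩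
    rw [hHu] at this
    linarith
  have hgb : ∀ x ∈ ball (0 : ℂ) r₀, |g x - g 0| ≤ Lg * r₀ := fun x hx => by
    refine (hgL x hx 0 (mem_ball_self hr₀)).trans ?_
    gcongr
    exact (mem_ball.1 hx).le
  have hα : -2 < α := by
    refine neg_two_lt_of_integrableOn_exp hr₀ (c := g 0 - Lg * r₀)
      (hintR.mono_set (sdiff_subset_sdiff_left (ball_subset_ball h0R))) fun w hw => ?_
    rw [hueq w hw]
    have h1 := (abs_le.1 (hgb w hw.1)).1
    have h2 := mul_nonneg hπ.le (hV0 w (ball_subset_ball h0R hw.1))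
    linarith
  set a := (max (-α) 0 + 2) / 2 with ha
  have ha1 : 1 ≤ a := by linarith [le_max_right (-α) 0]
  have ha2 : a < 2 := by
    have : max (-α) 0 < 2 := max_lt (by linarith) (by norm_num)
    linarith
  have haα : -α ≤ a := by
    have : max (-α) 0 < 2 := max_lt (by linarith) (by norm_num)
    linarith [le_max_left (-α) 0]
  set γ := (2 - a) / 4 with hγ
  have hγ0 : 0 < γ := by linarith
  have hγ1 : γ < 1 := by linarith
  obtain ⟨r₃, hr₃, D, hD, hexp⟩ := exists_exp_logPotential_le hfi hf0 hfs hloc hR0 hc hγ0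
    (by linarith)
  obtain ⟨r, hr, hr0, hr3⟩ : ∃ r > 0, r ≤ r₀ ∧ r ≤ r₃ :=
    ⟨min r₀ r₃, by positivity, min_le_left _ _, min_le_right _ _⟩
  have hrR : r ≤ R := hr0.trans h0R
  set A := |M| * (Real.exp (g 0 + Lg * r₀) * D) with hA
  have hA0 : 0 ≤ A := by positivity
  have hfle : ∀ y ∈ ball (0 : ℂ) r,
      f y ≤ A * ‖y‖ ^ (-a) * (1 + ∫ w, ‖y - w‖ ^ (-γ) * f w) := by
    intro y hy
    have hI0 : 0 ≤ ∫ w, ‖y - w‖ ^ (-γ) * f w :=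
      integral_nonneg fun w => mul_nonneg (by positivity) (hf0 w)
    rcases eq_or_ne y 0 with rfl | hy0
    · rw [hf, indicator_of_notMem (by simp)]; positivity
    have hy' : y ∈ ball (0 : ℂ) r₀ \ {0} := ⟨ball_subset_ball hr0 hy, hy0⟩
    have hyn : ‖y‖ < r := mem_ball_zero_iff.1 hy
    have hypos : 0 < ‖y‖ := norm_pos_iff.2 hy0
    have h1 : Real.exp (α * Real.log ‖y‖) ≤ ‖y‖ ^ (-a) := by
      rw [Real.rpow_def_of_pos hypos, Real.exp_le_exp]
      have : Real.log ‖y‖ ≤ 0 := Real.log_nonpos hypos.le (by linarith)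
      nlinarith
    have h2 : Real.exp (g y) ≤ Real.exp (g 0 + Lg * r₀) :=
      Real.exp_le_exp.2 (by linarith [(abs_le.1 (hgb y hy'.1)).2])
    have h3 := hexp y ⟨ball_subset_ball hr3 hy, hy0⟩
    calc f y ≤ |M| * Real.exp (u y) := hfM y ⟨ball_subset_ball hrR hy, hy0⟩
      _ = |M| * (Real.exp (α * Real.log ‖y‖) * (Real.exp ((2 * π)⁻¹ * V y) * Real.exp (g y))) := by
          rw [hueq y hy', Real.exp_add, Real.exp_add]
      _ ≤ |M| * (‖y‖ ^ (-a) * ((D * (1 + ∫ w, ‖y - w‖ ^ (-γ) * f w))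
            * Real.exp (g 0 + Lg * r₀))) := by gcongr
      _ = _ := by rw [hA]; ring
  obtain ⟨S, hS⟩ := exists_bound_rpow_neg_mul_of_le hfm hfi hf0 hr (by linarith) hA0
    (by linarith : 0 < a) hγ0 hγ0 (by linarith) hfle
  have hS0 : 0 ≤ S := le_trans (integral_nonneg fun w => mul_nonneg (by positivity) (hf0 w))
    (hS 0 (mem_ball_self (by positivity))).2
  have hB : 0 ≤ (2 * π)⁻¹ * (2 * γ⁻¹ * S) + Lg := by positivity
  refine ⟨α, hα, ⟨γ, hγ0.le⟩, hγ0, hγ1, r / 2, half_pos hr, fun w => (2 * π)⁻¹ * V w + g w,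
    ⟨⟨_, hB⟩, holderOnWith_of_abs_sub_le fun x hx y hy => ?_⟩, fun w hw =>
      hueq w ⟨ball_subset_ball (by linarith) hw.1, hw.2⟩⟩
  have hsR : ball (0 : ℂ) (r / 2) ⊆ ball 0 R := ball_subset_ball (by linarith)
  have hs0 : ball (0 : ℂ) (r / 2) ⊆ ball 0 r₀ := ball_subset_ball (by linarith)
  have hVxy := abs_logPotential_sub_le hfi hf0 hfs hR0 hc hγ0 hγ1.le (hsR hx) (hsR hy)
    (hS x hx).1 (hS y hy).1 (hS x hx).2 (hS y hy).2
  rw [← dist_eq_norm] at hVxy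
  have hgxy := hgL x (hs0 hx) y (hs0 hy)
  have hd1 : dist x y ≤ 1 := by
    have h1 := mem_ball.1 hx
    have h2 := mem_ball.1 hy
    have h3 := dist_triangle_right x y 0
    linarith
  have hdγ : dist x y ≤ dist x y ^ γ := Real.self_le_rpow_of_le_one dist_nonneg hd1 hγ1.le
  calc |(2 * π)⁻¹ * V x + g x - ((2 * π)⁻¹ * V y + g y)|
      = |(2 * π)⁻¹ * (V x - V y) + (g x - g y)| := by ring_nf
    _ ≤ (2 * π)⁻¹ * |V x - V y| + |g x - g y| := by
        refine (abs_add_le _ _).trans ?_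
        rw [abs_mul, abs_of_pos hπ]
    _ ≤ (2 * π)⁻¹ * (2 * γ⁻¹ * S * dist x y ^ γ) + Lg * dist x y ^ γ := by
        gcongr
        exact hgxy.trans (by gcongr)
    _ = ((2 * π)⁻¹ * (2 * γ⁻¹ * S) + Lg) * dist x y ^ γ := by ring

lemma laplacian_comp_repr_eq_lap {u : EuclideanSpace ℝ (Fin 2) → ℝ} {w : ℂ}
    (hu : ContDiffAt ℝ 2 (fun z => u (Complex.orthonormalBasisOneI.repr z)) w) :
    Laplacian.laplacian (fun z => u (Complex.orthonormalBasisOneI.repr z)) w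
      = lap u (Complex.orthonormalBasisOneI.repr w) := by
  set e := Complex.orthonormalBasisOneI.repr with he
  set v : ℂ → ℝ := fun z => u (e z) with hv
  have hcomp : ∀ (h : EuclideanSpace ℝ (Fin 2) → ℝ) (z y : ℂ),
      fderiv ℝ (fun z => h (e z)) z y = fderiv ℝ h (e z) (e y) := by
    intro h z y
    have := e.toContinuousLinearEquiv.comp_right_fderiv (f := h) (x := z)
    exact congrArg (fun l => l y) this
  have hd : DifferentiableAt ℝ (fderiv ℝ v) w :=
    (hu.fderiv_right (m := 1) (by norm_num)).differentiableAt (by norm_num)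
  have key : ∀ y : ℂ, fderiv ℝ (fderiv ℝ v) w y y
      = fderiv ℝ (fun x => fderiv ℝ u x (e y)) (e w) (e y) := by
    intro y
    rw [← hcomp (fun x => fderiv ℝ u x (e y)) w y]
    have h1 : (fun z => fderiv ℝ u (e z) (e y)) = fun z => fderiv ℝ v z y :=
      funext fun z => (hcomp u z y).symm
    rw [h1, fderiv_clm_apply hd (differentiableAt_const y)]
    simp
  have e0 : e 1 = EuclideanSpace.single 0 1 := by
    simpa using Complex.orthonormalBasisOneI.repr_self 0
  have e1 : e Complex.I = EuclideanSpace.single 1 1 := by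
    simpa using Complex.orthonormalBasisOneI.repr_self 1
  rw [InnerProductSpace.laplacian_eq_iteratedFDeriv_complexPlane]
  simp only [iteratedFDeriv_two_apply, lap, pderiv1, Fin.sum_univ_two]
  simp [key, e0, e1]
  rfl

/-- isolated singularity of the conformal Gaussian curvature equation
`-Δu = K e^u` on the punctured unit disc in `ℝ²`. -/
theorem stmt_0 (K u : EuclideanSpace ℝ (Fin 2) → ℝ)
    (hK0 : ∀ x ∈ ball (0 : EuclideanSpace ℝ (Fin 2)) 1, 0 ≤ K x)
    (hKbdd : ∃ M : ℝ, ∀ x ∈ ball (0 : EuclideanSpace ℝ (Fin 2)) 1, K x ≤ M)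
    (hu : ContDiffOn ℝ 2 u (ball (0 : EuclideanSpace ℝ (Fin 2)) 1 \ {0}))
    (heq : ∀ x ∈ ball (0 : EuclideanSpace ℝ (Fin 2)) 1 \ {0},
      -(lap u x) = K x * Real.exp (u x))
    (hint : IntegrableOn (fun x => Real.exp (u x))
      (ball (0 : EuclideanSpace ℝ (Fin 2)) 1 \ {0})) :
    ∃ α : ℝ, α > -2 ∧ ∃ γ : NNReal, 0 < γ ∧ γ < 1 ∧
      ∃ ε > (0 : ℝ), ∃ φ : EuclideanSpace ℝ (Fin 2) → ℝ,
        (∃ C : NNReal, HolderOnWith C γ φ (ball (0 : EuclideanSpace ℝ (Fin 2)) ε)) ∧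
        ∀ x ∈ ball (0 : EuclideanSpace ℝ (Fin 2)) ε \ {0},
          u x = α * Real.log ‖x‖ + φ x := by
  obtain ⟨M, hM⟩ := hKbdd
  set e := Complex.orthonormalBasisOneI.repr with he
  have hball : ∀ {r : ℝ} {z : ℂ}, z ∈ ball (0 : ℂ) r \ {0} ↔ e z ∈ ball 0 r \ {0} := by
    intro r z
    simp
  have hopen : IsOpen (ball (0 : ℂ) 1 \ {0}) := isOpen_ball.sdiff isClosed_singleton
  have hv : ContDiffOn ℝ 2 (fun z => u (e z)) (ball 0 1 \ {0}) :=
    hu.comp e.contDiff.contDiffOn fun z hz => hball.1 hz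
  have hlap : ∀ w ∈ ball (0 : ℂ) 1 \ {0}, -Laplacian.laplacian (fun z => u (e z)) w
      = K (e w) * Real.exp (u (e w)) := fun w hw => by
    rw [laplacian_comp_repr_eq_lap (hv.contDiffAt (hopen.mem_nhds hw)), heq _ (hball.1 hw)]
  have hintv : IntegrableOn (fun z => Real.exp (u (e z))) (ball 0 1 \ {0}) := by
    have hmp := Complex.orthonormalBasisOneI.measurePreserving_repr
    have := (hmp.integrableOn_comp_preimage e.toMeasurableEquiv.measurableEmbedding).2 hint
    refine this.mono_set fun z hz => hball.1 hz
  obtain ⟨α, hα, γ, hγ0, hγ1, r, hr, φ, ⟨C, hC⟩, hφ⟩ := exists_eq_log_add_holder_of_laplacian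
    (M := M) hv
    (fun w hw => by
      rw [hlap w hw]
      exact mul_nonneg (hK0 _ (hball.1 hw).1) (Real.exp_pos _).le)
    (fun w hw => by
      rw [hlap w hw]
      exact mul_le_mul_of_nonneg_right (hM _ (hball.1 hw).1) (Real.exp_pos _).le) hintv
  refine ⟨α, hα, γ, hγ0, hγ1, r, hr, fun x => φ (e.symm x), ⟨C, fun x hx y hy => ?_⟩,
    fun x hx => ?_⟩
  · rw [← e.symm.edist_map x y]
    exact hC _ (by simpa using hx) _ (by simpa using hy)
  · have := hφ (e.symm x) (hball.2 (by simpa using hx))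
    simpa using this

end
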